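/- arXiv:2110.08923 — 2 statements merged into one kernel-verified Lean document; each statement's English description precedes it below -/
import Mathlib

section
/- Under the Slater, strong duality and exploration assumptions, set τ = (1−γ)·ε/(4·log|A|). Then Algorithm 1 computes, within a total number of NPG iterations of order Õ(1/ε²) (i.e., O((1/ε²)·log(1/ε))), a policy π for the standard (unregularized) CMDP such that |V^{π*}(ρ) − V^π(ρ)| = O(ε) and max_{i∈[n]} [b_i − U_{g_i}^π(ρ)]₊ = O(ε), where π* is an optimal policy of the standard CMDP max_π V^π(ρ) subject to U_{g_i}^π(ρ) ≥ b_i for all i. -/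
open scoped BigOperators

section CMDP

variable {S A : Type} [Fintype S] [Fintype A]

/-- `P` is a transition kernel: each `P s a` is a probability distribution over states. -/
def IsKernel (P : S → A → S → ℝ) : Prop :=
  (∀ s a s', 0 ≤ P s a s') ∧ ∀ s a, ∑ s', P s a s' = 1

/-- `ρ` is a probability distribution over states. -/
def IsDist (ρ : S → ℝ) : Prop := (∀ s, 0 ≤ ρ s) ∧ ∑ s, ρ s = 1

/-- `π` is a (stationary, stochastic) policy. -/
def IsPolicy (π : S → A → ℝ) : Prop := (∀ s a, 0 ≤ π s a) ∧ ∀ s, ∑ a, π s a = 1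

/-- One step of the state-action distribution dynamics under kernel `P` and policy `π`. -/
noncomputable def stepDist (P : S → A → S → ℝ) (π : S → A → ℝ) (μ : S → A → ℝ) :
    S → A → ℝ :=
  fun s a => (∑ s', ∑ a', μ s' a' * P s' a' s) * π s a

/-- State-action distribution at time `t` of the Markov chain induced by `π`,
with initial state-action distribution `μ₀`. -/
noncomputable def trajSA (P : S → A → S → ℝ) (π : S → A → ℝ) (μ₀ : S → A → ℝ) :
    ℕ → S → A → ℝ
  | 0 => μ₀
  | (t + 1) => stepDist P π (trajSA P π μ₀ t)

/-- Initial state-action distribution when `s₀ ∼ ρ`, `a₀ ∼ π(·|s₀)`. -/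
noncomputable def initSA (ρ : S → ℝ) (π : S → A → ℝ) : S → A → ℝ := fun s a => ρ s * π s a

/-- Initial state-action distribution that is a Dirac at `(s₀, a₀)`. -/
noncomputable def diracSA [DecidableEq S] [DecidableEq A] (s₀ : S) (a₀ : A) : S → A → ℝ :=
  fun s a => if s = s₀ ∧ a = a₀ then 1 else 0

/-- Expected discounted cumulative value `E[∑ γ^t c(s_t,a_t)]` with initial
state-action distribution `μ₀`. -/
noncomputable def dsum (γ : ℝ) (P : S → A → S → ℝ) (π : S → A → ℝ) (μ₀ : S → A → ℝ)
    (c : S → A → ℝ) : ℝ :=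
  ∑' t : ℕ, γ ^ t * ∑ s, ∑ a, trajSA P π μ₀ t s a * c s a

/-- Value function `V^π(ρ)` (for reward/utility `c`). -/
noncomputable def Vval (γ : ℝ) (P : S → A → S → ℝ) (π : S → A → ℝ) (ρ : S → ℝ)
    (c : S → A → ℝ) : ℝ := dsum γ P π (initSA ρ π) c

/-- Q-function `Q^π(s,a)` (for reward/utility `c`). -/
noncomputable def Qval [DecidableEq S] [DecidableEq A] (γ : ℝ) (P : S → A → S → ℝ)
    (π : S → A → ℝ) (s : S) (a : A) (c : S → A → ℝ) : ℝ :=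
  dsum γ P π (diracSA s a) c

/-- Discounted state visitation distribution `d_ρ^π(s)`. -/
noncomputable def visit (γ : ℝ) (P : S → A → S → ℝ) (π : S → A → ℝ) (ρ : S → ℝ)
    (s : S) : ℝ :=
  (1 - γ) * ∑' t : ℕ, γ ^ t * ∑ a, trajSA P π (initSA ρ π) t s a

/-- Discounted entropy `H(ρ, π)`. -/
noncomputable def Hent (γ : ℝ) (P : S → A → S → ℝ) (π : S → A → ℝ) (ρ : S → ℝ) : ℝ :=
  Vval γ P π ρ (fun s a => -Real.log (π s a))

/-- Entropy-regularized value function `V_τ^π(ρ)`. -/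
noncomputable def Vtau (γ τ : ℝ) (P : S → A → S → ℝ) (π : S → A → ℝ) (ρ : S → ℝ)
    (c : S → A → ℝ) : ℝ := Vval γ P π ρ c + τ * Hent γ P π ρ

/-- Euclidean norm of a vector indexed by state-action pairs. -/
noncomputable def polNorm2 (x : S → A → ℝ) : ℝ := Real.sqrt (∑ s, ∑ a, (x s a) ^ 2)

/-- Euclidean norm of a vector in `ℝ^n`. -/
noncomputable def vecNorm2 {n : ℕ} (x : Fin n → ℝ) : ℝ := Real.sqrt (∑ i, (x i) ^ 2)

/-- The soft-max policy associated with parameter `θ`. -/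
noncomputable def softmaxPol (θ : S → A → ℝ) : S → A → ℝ :=
  fun s a => Real.exp (θ s a) / ∑ a', Real.exp (θ s a')

/-- Membership in the soft-max policy class `Π`. -/
def InSoftmax (π : S → A → ℝ) : Prop := ∃ θ : S → A → ℝ, π = softmaxPol θ

/-- Lagrangian `L(π, λ)` of the entropy-regularized CMDP. -/
noncomputable def Lag (γ τ : ℝ) (P : S → A → S → ℝ) (ρ : S → ℝ) (r : S → A → ℝ)
    {n : ℕ} (g : Fin n → S → A → ℝ) (b : Fin n → ℝ) (π : S → A → ℝ)
    (lam : Fin n → ℝ) : ℝ :=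
  Vtau γ τ P π ρ r + ∑ i, lam i * (Vval γ P π ρ (g i) - b i)

/-- Dual function `D(λ) = max_{π ∈ Π} L(π, λ)`. -/
noncomputable def Dual (γ τ : ℝ) (P : S → A → S → ℝ) (ρ : S → ℝ) (r : S → A → ℝ)
    {n : ℕ} (g : Fin n → S → A → ℝ) (b : Fin n → ℝ) (lam : Fin n → ℝ) : ℝ :=
  sSup ((fun π : S → A → ℝ => Lag γ τ P ρ r g b π lam) '' {π | InSoftmax π})

end CMDP

section Algorithms

variable {S A : Type} [Fintype S] [Fintype A]

/-- Dirac distribution at a state. -/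
noncomputable def diracS [DecidableEq S] (s₀ : S) : S → ℝ := fun s => if s = s₀ then 1 else 0

/-- Entropy-regularized value function from a single state, for reward `c`. -/
noncomputable def VtauState [DecidableEq S] (γ τ : ℝ) (P : S → A → S → ℝ)
    (π : S → A → ℝ) (c : S → A → ℝ) (s : S) : ℝ :=
  Vtau γ τ P π (diracS s) c

/-- Soft Q-function for reward `c`:
`Q̃_τ^π(s,a) = c(s,a) + γ·E_{s′∼P(·|s,a)}[Ṽ_τ^π(s′)]`. -/
noncomputable def Qtau [DecidableEq S] (γ τ : ℝ) (P : S → A → S → ℝ)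
    (π : S → A → ℝ) (c : S → A → ℝ) (s : S) (a : A) : ℝ :=
  c s a + γ * ∑ s', P s a s' * VtauState γ τ P π c s'

/-- One step of the entropy-regularized natural policy gradient method with step size `η`
for reward `c`:
`π⁺(a|s) ∝ π(a|s)^{1−ητ/(1−γ)}·exp(η·Q̃_τ^π(s,a)/(1−γ))`. -/
noncomputable def npgStep [DecidableEq S] (γ τ η : ℝ) (P : S → A → S → ℝ)
    (c : S → A → ℝ) (π : S → A → ℝ) : S → A → ℝ :=
  fun s a =>
    (π s a) ^ (1 - η * τ / (1 - γ)) * Real.exp (η * Qtau γ τ P π c s a / (1 - γ)) /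
      ∑ a', (π s a') ^ (1 - η * τ / (1 - γ)) * Real.exp (η * Qtau γ τ P π c s a' / (1 - γ))

/-- The reward `r_λ(s,a) = r(s,a) + Σ_i λ_i·g_i(s,a)` associated with a multiplier. -/
noncomputable def rLam (r : S → A → ℝ) {n : ℕ} (g : Fin n → S → A → ℝ)
    (lam : Fin n → ℝ) : S → A → ℝ :=
  fun s a => r s a + ∑ i, lam i * g i s a

end Algorithms

section Occupancy

variable {S A : Type} [Fintype S] [Fintype A]

/-- Unnormalized discounted state occupancy measure. -/
noncomputable def occ (γ : ℝ) (P : S → A → S → ℝ) (π : S → A → ℝ) (ρ : S → ℝ) (s : S) : ℝ :=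
  ∑' t : ℕ, γ ^ t * ∑ a, trajSA P π (initSA ρ π) t s a

/-- One-step lookahead at a state-action pair: the cost plus the discounted expectation of `f`. -/
noncomputable def backup (γ : ℝ) (P : S → A → S → ℝ) (c : S → A → ℝ) (f : S → ℝ)
    (s : S) (a : A) : ℝ :=
  c s a + γ * ∑ s', P s a s' * f s'

variable {γ τ : ℝ} {P : S → A → S → ℝ} {π : S → A → ℝ} {ρ : S → ℝ}

lemma trajSA_initSA_eq (hπ : IsPolicy π) (t : ℕ) (s : S) (a : A) :
    trajSA P π (initSA ρ π) t s a = (∑ a', trajSA P π (initSA ρ π) t s a') * π s a := by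
  cases t with
  | zero => simp only [trajSA, initSA, ← Finset.mul_sum, hπ.2, mul_one]
  | succ t => simp only [trajSA, stepDist, ← Finset.mul_sum, hπ.2, mul_one]

lemma trajSA_nonneg (hP : IsKernel P) (hπ : IsPolicy π) (hρ : IsDist ρ) (t : ℕ) (s : S) (a : A) :
    0 ≤ trajSA P π (initSA ρ π) t s a := by
  induction t generalizing s a with
  | zero => exact mul_nonneg (hρ.1 s) (hπ.1 s a)
  | succ t ih =>
    exact mul_nonneg (Finset.sum_nonneg fun s' _ => Finset.sum_nonneg fun a' _ =>
      mul_nonneg (ih s' a') (hP.1 _ _ _)) (hπ.1 s a)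

lemma trajSA_marginal_succ (hπ : IsPolicy π) (t : ℕ) (s : S) :
    ∑ a, trajSA P π (initSA ρ π) (t + 1) s a =
      ∑ s', (∑ a, trajSA P π (initSA ρ π) t s' a) * ∑ a', π s' a' * P s' a' s := by
  simp only [trajSA, stepDist, ← Finset.mul_sum, hπ.2, mul_one]
  refine Finset.sum_congr rfl fun s' _ => ?_
  rw [Finset.mul_sum]
  refine Finset.sum_congr rfl fun a' _ => ?_
  rw [trajSA_initSA_eq hπ t s' a']
  ring

lemma trajSA_sum (hP : IsKernel P) (hπ : IsPolicy π) (hρ : IsDist ρ) (t : ℕ) :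
    ∑ s, ∑ a, trajSA P π (initSA ρ π) t s a = 1 := by
  induction t with
  | zero => simp only [trajSA, initSA, ← Finset.mul_sum, hπ.2, mul_one, hρ.2]
  | succ t ih =>
    simp only [trajSA_marginal_succ hπ]
    rw [Finset.sum_comm]
    rw [← ih]
    refine Finset.sum_congr rfl fun s' _ => ?_
    rw [← Finset.mul_sum, Finset.sum_comm]
    simp only [← Finset.mul_sum, hP.2, mul_one, hπ.2]

lemma trajSA_marginal_nonneg (hP : IsKernel P) (hπ : IsPolicy π) (hρ : IsDist ρ) (t : ℕ) (s : S) :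
    0 ≤ ∑ a, trajSA P π (initSA ρ π) t s a :=
  Finset.sum_nonneg fun a _ => trajSA_nonneg hP hπ hρ t s a

lemma trajSA_marginal_le_one (hP : IsKernel P) (hπ : IsPolicy π) (hρ : IsDist ρ) (t : ℕ) (s : S) :
    ∑ a, trajSA P π (initSA ρ π) t s a ≤ 1 := by
  rw [← trajSA_sum hP hπ hρ t]
  exact Finset.single_le_sum (f := fun s => ∑ a, trajSA P π (initSA ρ π) t s a)
    (fun s _ => trajSA_marginal_nonneg hP hπ hρ t s) (Finset.mem_univ s)

lemma hasSum_occ (hP : IsKernel P) (hγ : γ ∈ Set.Ico (0 : ℝ) 1) (hπ : IsPolicy π) (hρ : IsDist ρ)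
    (s : S) :
    HasSum (fun t : ℕ => γ ^ t * ∑ a, trajSA P π (initSA ρ π) t s a) (occ γ P π ρ s) := by
  refine Summable.hasSum (Summable.of_nonneg_of_le (fun t => ?_) (fun t => ?_)
    (summable_geometric_of_lt_one hγ.1 hγ.2))
  · exact mul_nonneg (pow_nonneg hγ.1 t) (trajSA_marginal_nonneg hP hπ hρ t s)
  · exact mul_le_of_le_one_right (pow_nonneg hγ.1 t) (trajSA_marginal_le_one hP hπ hρ t s)

lemma occ_nonneg (hP : IsKernel P) (hγ : γ ∈ Set.Ico (0 : ℝ) 1) (hπ : IsPolicy π) (hρ : IsDist ρ)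
    (s : S) : 0 ≤ occ γ P π ρ s :=
  (hasSum_occ hP hγ hπ hρ s).nonneg fun t =>
    mul_nonneg (pow_nonneg hγ.1 t) (trajSA_marginal_nonneg hP hπ hρ t s)

lemma sum_occ (hP : IsKernel P) (hγ : γ ∈ Set.Ico (0 : ℝ) 1) (hπ : IsPolicy π) (hρ : IsDist ρ) :
    ∑ s, occ γ P π ρ s = 1 / (1 - γ) := by
  have h := hasSum_sum (s := Finset.univ) fun s _ => hasSum_occ hP hγ hπ hρ s
  simp only [← Finset.mul_sum, trajSA_sum hP hπ hρ, mul_one] at h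
  rw [h.unique (hasSum_geometric_of_lt_one hγ.1 hγ.2), one_div]

lemma Vval_eq_sum_occ (hP : IsKernel P) (hγ : γ ∈ Set.Ico (0 : ℝ) 1) (hπ : IsPolicy π)
    (hρ : IsDist ρ) (c : S → A → ℝ) :
    Vval γ P π ρ c = ∑ s, occ γ P π ρ s * ∑ a, π s a * c s a := by
  have h := hasSum_sum (s := Finset.univ) fun s _ =>
    (hasSum_occ hP hγ hπ hρ s).mul_right (∑ a, π s a * c s a)
  rw [← h.tsum_eq]
  refine tsum_congr fun t => ?_
  rw [Finset.mul_sum]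
  refine Finset.sum_congr rfl fun s _ => ?_
  rw [mul_assoc, Finset.mul_sum Finset.univ _ (∑ a, trajSA P π (initSA ρ π) t s a)]
  congr 1
  refine Finset.sum_congr rfl fun a _ => ?_
  rw [trajSA_initSA_eq hπ t s a]
  ring

lemma occ_flow (hP : IsKernel P) (hγ : γ ∈ Set.Ico (0 : ℝ) 1) (hπ : IsPolicy π) (hρ : IsDist ρ)
    (s : S) :
    occ γ P π ρ s = ρ s + γ * ∑ s', occ γ P π ρ s' * ∑ a', π s' a' * P s' a' s := by
  have h0 := hasSum_occ hP hγ hπ hρ s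
  have h := (hasSum_sum (s := Finset.univ) fun s' _ =>
    (hasSum_occ hP hγ hπ hρ s').mul_right (∑ a', π s' a' * P s' a' s)).mul_left γ
  rw [occ, h0.summable.tsum_eq_zero_add, ← h.tsum_eq]
  congr 1
  · simp only [trajSA, initSA, ← Finset.mul_sum, hπ.2, mul_one, pow_zero, one_mul]
  · refine tsum_congr fun t => ?_
    rw [trajSA_marginal_succ hπ, Finset.mul_sum, Finset.mul_sum]
    refine Finset.sum_congr rfl fun s' _ => ?_
    ring

/-- General performance-difference identity: compares a value with an arbitrary state function. -/
lemma Vval_sub_sum (hP : IsKernel P) (hγ : γ ∈ Set.Ico (0 : ℝ) 1) (hπ : IsPolicy π)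
    (hρ : IsDist ρ) (c : S → A → ℝ) (f : S → ℝ) :
    Vval γ P π ρ c - ∑ s, ρ s * f s =
      ∑ s, occ γ P π ρ s * (∑ a, π s a * backup γ P c f s a - f s) := by
  have h1 : ∑ s, ρ s * f s = ∑ s, occ γ P π ρ s * f s -
      ∑ s, occ γ P π ρ s * ∑ a, π s a * (γ * ∑ s', P s a s' * f s') := by
    have h2 : ∀ s, ρ s * f s = occ γ P π ρ s * f s -
        ∑ s', occ γ P π ρ s' * ∑ a', π s' a' * (γ * (P s' a' s * f s)) := by
      intro s
      have h3 : ∑ s', occ γ P π ρ s' * ∑ a', π s' a' * (γ * (P s' a' s * f s)) =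
          (γ * ∑ s', occ γ P π ρ s' * ∑ a', π s' a' * P s' a' s) * f s := by
        rw [Finset.mul_sum, Finset.sum_mul]
        refine Finset.sum_congr rfl fun s' _ => ?_
        have h4 : ∑ a', π s' a' * (γ * (P s' a' s * f s)) =
            γ * (∑ a', π s' a' * P s' a' s) * f s := by
          rw [Finset.mul_sum, Finset.sum_mul]
          exact Finset.sum_congr rfl fun a' _ => by ring
        rw [h4]
        ring
      rw [h3]
      nth_rewrite 1 [occ_flow hP hγ hπ hρ s]
      ring
    rw [Finset.sum_congr rfl fun s _ => h2 s, Finset.sum_sub_distrib]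
    congr 1
    rw [Finset.sum_comm]
    refine Finset.sum_congr rfl fun s' _ => ?_
    rw [← Finset.mul_sum, Finset.sum_comm]
    congr 1
    refine Finset.sum_congr rfl fun a' _ => ?_
    rw [Finset.mul_sum, Finset.mul_sum]
  rw [Vval_eq_sum_occ hP hγ hπ hρ, h1, sub_sub_eq_add_sub, ← Finset.sum_add_distrib,
    ← Finset.sum_sub_distrib]
  refine Finset.sum_congr rfl fun s _ => ?_
  simp only [backup, mul_add, Finset.sum_add_distrib]
  ring

lemma Vtau_eq_Vval (hP : IsKernel P) (hγ : γ ∈ Set.Ico (0 : ℝ) 1) (hπ : IsPolicy π)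
    (hρ : IsDist ρ) (c : S → A → ℝ) :
    Vtau γ τ P π ρ c = Vval γ P π ρ (fun s a => c s a - τ * Real.log (π s a)) := by
  rw [Vtau, Hent, Vval_eq_sum_occ hP hγ hπ hρ, Vval_eq_sum_occ hP hγ hπ hρ,
    Vval_eq_sum_occ hP hγ hπ hρ, Finset.mul_sum, ← Finset.sum_add_distrib]
  refine Finset.sum_congr rfl fun s _ => ?_
  rw [mul_left_comm, ← mul_add, Finset.mul_sum, ← Finset.sum_add_distrib]
  congr 1
  refine Finset.sum_congr rfl fun a _ => ?_
  ring

lemma Vtau_sub_sum (hP : IsKernel P) (hγ : γ ∈ Set.Ico (0 : ℝ) 1) (hπ : IsPolicy π)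
    (hρ : IsDist ρ) (c : S → A → ℝ) (f : S → ℝ) :
    Vtau γ τ P π ρ c - ∑ s, ρ s * f s =
      ∑ s, occ γ P π ρ s * (∑ a, π s a * (backup γ P c f s a - τ * Real.log (π s a)) - f s) := by
  rw [Vtau_eq_Vval hP hγ hπ hρ, Vval_sub_sum hP hγ hπ hρ]
  refine Finset.sum_congr rfl fun s _ => ?_
  congr 2
  refine Finset.sum_congr rfl fun a _ => ?_
  simp only [backup]
  ring

lemma visit_le_one (hP : IsKernel P) (hγ : γ ∈ Set.Ico (0 : ℝ) 1) (hπ : IsPolicy π)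
    (hρ : IsDist ρ) (s : S) : visit γ P π ρ s ≤ 1 := by
  have h1 : occ γ P π ρ s ≤ 1 / (1 - γ) := by
    rw [← sum_occ hP hγ hπ hρ]
    exact Finset.single_le_sum (fun s _ => occ_nonneg hP hγ hπ hρ s) (Finset.mem_univ s)
  have h2 : 0 < 1 - γ := sub_pos.2 hγ.2
  rw [le_div_iff₀ h2] at h1
  rw [visit, mul_comm]
  exact h1

lemma Vval_mono (hP : IsKernel P) (hγ : γ ∈ Set.Ico (0 : ℝ) 1) (hπ : IsPolicy π)
    (hρ : IsDist ρ) {c c' : S → A → ℝ} (h : ∀ s, ∑ a, π s a * c s a ≤ ∑ a, π s a * c' s a) :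
    Vval γ P π ρ c ≤ Vval γ P π ρ c' := by
  rw [Vval_eq_sum_occ hP hγ hπ hρ, Vval_eq_sum_occ hP hγ hπ hρ]
  exact Finset.sum_le_sum fun s _ =>
    mul_le_mul_of_nonneg_left (h s) (occ_nonneg hP hγ hπ hρ s)

lemma Vval_const (hP : IsKernel P) (hγ : γ ∈ Set.Ico (0 : ℝ) 1) (hπ : IsPolicy π)
    (hρ : IsDist ρ) (x : ℝ) : Vval γ P π ρ (fun _ _ => x) = x / (1 - γ) := by
  rw [Vval_eq_sum_occ hP hγ hπ hρ]
  simp only [← Finset.sum_mul, hπ.2, one_mul, sum_occ hP hγ hπ hρ]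
  ring

end Occupancy

section InformationInequalities

lemma sqrt_sub_sq_le_mul_log {p q : ℝ} (hp : 0 ≤ p) (hq : 0 < q) :
    (√p - √q) ^ 2 + p - q ≤ p * (Real.log p - Real.log q) := by
  rcases hp.eq_or_lt with rfl | hp
  · simp [Real.sq_sqrt hq.le]
  · have ha := Real.sqrt_pos.2 hp
    have hb := Real.sqrt_pos.2 hq
    have h1 : Real.log (√q / √p) ≤ √q / √p - 1 := Real.log_le_sub_one_of_pos (div_pos hb ha)
    rw [Real.log_div hb.ne' ha.ne', Real.log_sqrt hp.le, Real.log_sqrt hq.le] at h1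
    have h2 : p * (√q / √p) = √p * √q := by
      nth_rewrite 1 [← Real.mul_self_sqrt hp.le]
      field_simp
    have h3 := mul_le_mul_of_nonneg_left h1 hp.le
    nlinarith [Real.sq_sqrt hp.le, Real.sq_sqrt hq.le]

variable {A : Type} [Fintype A] {p q : A → ℝ}

lemma hellinger_le_kl (hp : ∀ a, 0 ≤ p a) (hq : ∀ a, 0 < q a) (hp1 : ∑ a, p a = 1)
    (hq1 : ∑ a, q a = 1) :
    ∑ a, (√(p a) - √(q a)) ^ 2 ≤ ∑ a, p a * (Real.log (p a) - Real.log (q a)) := by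
  have h := Finset.sum_le_sum fun a (_ : a ∈ Finset.univ) => sqrt_sub_sq_le_mul_log (hp a) (hq a)
  rw [Finset.sum_sub_distrib, Finset.sum_add_distrib, hp1, hq1] at h
  linarith

lemma kl_nonneg (hp : ∀ a, 0 ≤ p a) (hq : ∀ a, 0 < q a) (hp1 : ∑ a, p a = 1)
    (hq1 : ∑ a, q a = 1) : 0 ≤ ∑ a, p a * (Real.log (p a) - Real.log (q a)) :=
  (Finset.sum_nonneg fun _ _ => sq_nonneg _).trans (hellinger_le_kl hp hq hp1 hq1)

/-- Pinsker's inequality, up to a factor two in the constant. -/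
lemma sq_sum_abs_sub_le_kl (hp : ∀ a, 0 ≤ p a) (hq : ∀ a, 0 < q a) (hp1 : ∑ a, p a = 1)
    (hq1 : ∑ a, q a = 1) :
    (∑ a, |p a - q a|) ^ 2 ≤ 4 * ∑ a, p a * (Real.log (p a) - Real.log (q a)) := by
  have h1 : ∀ a, |p a - q a| = |√(p a) - √(q a)| * (√(p a) + √(q a)) := by
    intro a
    rw [← abs_of_nonneg (add_nonneg (Real.sqrt_nonneg (p a)) (Real.sqrt_nonneg (q a))), ← abs_mul]
    congr 1
    nlinarith [Real.sq_sqrt (hp a), Real.sq_sqrt (hq a).le]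
  have h2 : ∑ a, (√(p a) + √(q a)) ^ 2 ≤ 4 := by
    have h3 : ∀ a, (√(p a) + √(q a)) ^ 2 ≤ 2 * p a + 2 * q a := by
      intro a
      nlinarith [Real.sq_sqrt (hp a), Real.sq_sqrt (hq a).le, sq_nonneg (√(p a) - √(q a))]
    refine (Finset.sum_le_sum fun a _ => h3 a).trans ?_
    rw [Finset.sum_add_distrib, ← Finset.mul_sum, ← Finset.mul_sum, hp1, hq1]
    norm_num
  simp only [h1]
  refine (Finset.sum_mul_sq_le_sq_mul_sq _ _ _).trans ?_
  simp only [sq_abs]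
  have h4 := hellinger_le_kl hp hq hp1 hq1
  have h5 : 0 ≤ ∑ a, (√(p a) - √(q a)) ^ 2 := Finset.sum_nonneg fun _ _ => sq_nonneg _
  nlinarith

/-- A probability vector tested against a function with values in `[0, B]`. -/
lemma sq_sum_sub_mul_le_kl (hp : ∀ a, 0 ≤ p a) (hq : ∀ a, 0 < q a) (hp1 : ∑ a, p a = 1)
    (hq1 : ∑ a, q a = 1) {B : ℝ} {Q : A → ℝ} (hQ : ∀ a, Q a ∈ Set.Icc 0 B) :
    (∑ a, (p a - q a) * Q a) ^ 2 ≤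
      B ^ 2 * ∑ a, p a * (Real.log (p a) - Real.log (q a)) := by
  have h1 : ∑ a, (p a - q a) * Q a = ∑ a, (p a - q a) * (Q a - B / 2) := by
    simp only [mul_sub, Finset.sum_sub_distrib, ← Finset.sum_mul, hp1, hq1]
    ring
  have h2 : |∑ a, (p a - q a) * Q a| ≤ (∑ a, |p a - q a|) * (B / 2) := by
    rw [h1, Finset.sum_mul]
    refine (Finset.abs_sum_le_sum_abs _ _).trans (Finset.sum_le_sum fun a _ => ?_)
    rw [abs_mul]
    refine mul_le_mul_of_nonneg_left ?_ (abs_nonneg _)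
    rw [abs_le]
    constructor <;> linarith [(hQ a).1, (hQ a).2]
  have h3 := sq_sum_abs_sub_le_kl hp hq hp1 hq1
  rw [← sq_abs]
  refine (pow_le_pow_left₀ (abs_nonneg _) h2 2).trans ?_
  nlinarith [mul_le_mul_of_nonneg_left h3 (sq_nonneg B)]

end InformationInequalities

section SoftmaxPolicies

variable {S A : Type} [Fintype A]

lemma sum_exp_pos [Nonempty A] (θ : A → ℝ) : 0 < ∑ a, Real.exp (θ a) :=
  Finset.sum_pos (fun _ _ => Real.exp_pos _) Finset.univ_nonempty

lemma InSoftmax.pos [Nonempty A] {π : S → A → ℝ} (h : InSoftmax π) (s : S) (a : A) :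
    0 < π s a := by
  obtain ⟨θ, rfl⟩ := h
  exact div_pos (Real.exp_pos _) (sum_exp_pos _)

lemma InSoftmax.isPolicy [Nonempty A] {π : S → A → ℝ} (h : InSoftmax π) : IsPolicy π := by
  refine ⟨fun s a => (h.pos s a).le, fun s => ?_⟩
  obtain ⟨θ, rfl⟩ := h
  simp only [softmaxPol, ← Finset.sum_div]
  exact div_self (sum_exp_pos _).ne'

lemma log_softmaxPol [Nonempty A] (θ : S → A → ℝ) (s : S) (a : A) :
    Real.log (softmaxPol θ s a) = θ s a - Real.log (∑ a', Real.exp (θ s a')) := by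
  rw [softmaxPol, Real.log_div (Real.exp_pos _).ne' (sum_exp_pos _).ne', Real.log_exp]

lemma entropy_le_log_card [Nonempty A] {p : A → ℝ} (hp : ∀ a, 0 ≤ p a) (hp1 : ∑ a, p a = 1) :
    ∑ a, p a * (-Real.log (p a)) ≤ Real.log (Fintype.card A) := by
  have hc : (0 : ℝ) < Fintype.card A := by exact_mod_cast Fintype.card_pos
  have h := kl_nonneg (q := fun _ : A => ((Fintype.card A : ℝ))⁻¹) hp
    (fun _ => inv_pos.2 hc) hp1 (by simp [hc.ne'])
  simp only [Real.log_inv, mul_sub, Finset.sum_sub_distrib, ← Finset.sum_mul, hp1] at h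
  simp only [mul_neg, Finset.sum_neg_distrib]
  linarith

lemma entropy_nonneg {p : A → ℝ} (hp : ∀ a, 0 ≤ p a) (hp1 : ∑ a, p a = 1) :
    0 ≤ ∑ a, p a * (-Real.log (p a)) := by
  refine Finset.sum_nonneg fun a _ => mul_nonneg (hp a) (neg_nonneg.2 ?_)
  refine Real.log_nonpos (hp a) ?_
  rw [← hp1]
  exact Finset.single_le_sum (fun a _ => hp a) (Finset.mem_univ a)

/-- Gibbs variational inequality. -/
lemma gibbs_le [Nonempty A] {τ : ℝ} (hτ : 0 < τ) {p : A → ℝ} (hp : ∀ a, 0 ≤ p a)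
    (hp1 : ∑ a, p a = 1) (x : A → ℝ) :
    ∑ a, p a * (x a - τ * Real.log (p a)) ≤ τ * Real.log (∑ a, Real.exp (x a / τ)) := by
  have hZ := sum_exp_pos fun a => x a / τ
  have h := kl_nonneg (q := fun a => Real.exp (x a / τ) / ∑ a', Real.exp (x a' / τ)) hp
    (fun a => div_pos (Real.exp_pos _) hZ) hp1 (by rw [← Finset.sum_div]; exact div_self hZ.ne')
  have h1 : ∀ a, p a * (x a - τ * Real.log (p a)) = τ * (p a * Real.log (∑ a', Real.exp (x a' / τ)))
      - τ * (p a * (Real.log (p a) -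
        Real.log (Real.exp (x a / τ) / ∑ a', Real.exp (x a' / τ)))) := by
    intro a
    rw [Real.log_div (Real.exp_pos _).ne' hZ.ne', Real.log_exp]
    field_simp
    ring
  simp only [h1, Finset.sum_sub_distrib, ← Finset.mul_sum, ← Finset.sum_mul, hp1, one_mul]
  nlinarith

end SoftmaxPolicies

section Bellman

variable {S A : Type} [Fintype S] [Fintype A] {γ τ : ℝ} {P : S → A → S → ℝ} {π : S → A → ℝ}
  {ρ : S → ℝ} {c : S → A → ℝ}

omit [Fintype A] in
lemma exists_fixed_point (hγ : γ ∈ Set.Ico (0 : ℝ) 1) (F : (S → ℝ) → S → ℝ)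
    (hF : ∀ f g : S → ℝ, ∀ e : ℝ, 0 ≤ e → (∀ s, f s ≤ g s + e) → ∀ s, F f s ≤ F g s + γ * e) :
    ∃ f, F f = f := by
  have hc : ContractingWith ⟨γ, hγ.1⟩ F := by
    refine ⟨hγ.2, LipschitzWith.of_dist_le_mul fun f g => ?_⟩
    have h : ∀ f g : S → ℝ, ∀ s, f s ≤ g s + dist f g := by
      intro f g s
      have := (le_abs_self _).trans ((Real.dist_eq (f s) (g s)).symm.le.trans (dist_le_pi_dist f g s))
      linarith
    refine (dist_pi_le_iff (mul_nonneg hγ.1 dist_nonneg)).2 fun s => ?_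
    have h1 := hF f g _ dist_nonneg (h f g) s
    have h2 := hF g f _ dist_nonneg (h g f) s
    rw [dist_comm g f] at h2
    have h3 : dist (F f s) (F g s) ≤ γ * dist f g := by
      rw [Real.dist_eq, abs_le]
      constructor <;> linarith
    exact h3
  exact ⟨_, hc.fixedPoint_isFixedPt⟩

omit [Fintype A] in
lemma backup_le (hP : IsKernel P) (hγ : γ ∈ Set.Ico (0 : ℝ) 1) {f g : S → ℝ} {e : ℝ}
    (h : ∀ s, f s ≤ g s + e) (s : S) (a : A) :
    backup γ P c f s a ≤ backup γ P c g s a + γ * e := by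
  have h1 : ∑ s', P s a s' * f s' ≤ ∑ s', P s a s' * g s' + e := by
    calc ∑ s', P s a s' * f s' ≤ ∑ s', P s a s' * (g s' + e) :=
          Finset.sum_le_sum fun s' _ => mul_le_mul_of_nonneg_left (h s') (hP.1 s a s')
      _ = _ := by simp only [mul_add, Finset.sum_add_distrib, ← Finset.sum_mul, hP.2, one_mul]
  have := mul_le_mul_of_nonneg_left h1 hγ.1
  simp only [backup]
  linarith

lemma log_sum_exp_le [Nonempty A] (hτ : 0 < τ) {x y : A → ℝ} {e : ℝ} (h : ∀ a, x a ≤ y a + e) :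
    τ * Real.log (∑ a, Real.exp (x a / τ)) ≤ τ * Real.log (∑ a, Real.exp (y a / τ)) + e := by
  have h1 : ∑ a, Real.exp (x a / τ) ≤ Real.exp (e / τ) * ∑ a, Real.exp (y a / τ) := by
    rw [Finset.mul_sum]
    refine Finset.sum_le_sum fun a _ => ?_
    rw [← Real.exp_add, ← add_div, Real.exp_le_exp]
    exact div_le_div_of_nonneg_right (by linarith [h a]) hτ.le
  have h2 := Real.log_le_log (sum_exp_pos fun a => x a / τ) h1
  rw [Real.log_mul (Real.exp_pos _).ne' (sum_exp_pos _).ne', Real.log_exp] at h2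
  have h3 := mul_le_mul_of_nonneg_left h2 hτ.le
  rw [mul_add, mul_div_cancel₀ _ hτ.ne'] at h3
  linarith

lemma Vtau_zero (c : S → A → ℝ) : Vtau γ 0 P π ρ c = Vval γ P π ρ c := by
  simp [Vtau]

variable [DecidableEq S]

omit [Fintype A] in
lemma isDist_diracS (s : S) : IsDist (diracS s) :=
  ⟨fun s' => by simp only [diracS]; split_ifs <;> norm_num, by simp [diracS]⟩

omit [Fintype A] in
lemma sum_diracS_mul (s : S) (f : S → ℝ) : ∑ s', diracS s s' * f s' = f s := by
  simp [diracS]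

lemma VtauState_bellman (hP : IsKernel P) (hγ : γ ∈ Set.Ico (0 : ℝ) 1) (hπ : IsPolicy π) (s : S) :
    ∑ a, π s a * (backup γ P c (VtauState γ τ P π c) s a - τ * Real.log (π s a)) =
      VtauState γ τ P π c s := by
  obtain ⟨f, hf⟩ := exists_fixed_point hγ
    (fun f s => ∑ a, π s a * (backup γ P c f s a - τ * Real.log (π s a))) (by
      intro f g e _ h s
      have h1 : ∑ a, π s a * (backup γ P c f s a - τ * Real.log (π s a)) ≤
          ∑ a, π s a * (backup γ P c g s a - τ * Real.log (π s a) + γ * e) :=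
        Finset.sum_le_sum fun a _ =>
          mul_le_mul_of_nonneg_left (by linarith [backup_le (c := c) hP hγ h s a]) (hπ.1 s a)
      simp only [mul_add, Finset.sum_add_distrib, ← Finset.sum_mul, hπ.2, one_mul] at h1
      exact h1)
  have hf' : VtauState γ τ P π c = f := by
    funext s
    have h := Vtau_sub_sum (τ := τ) hP hγ hπ (isDist_diracS s) c f
    rw [sum_diracS_mul] at h
    refine sub_eq_zero.1 (h.trans (Finset.sum_eq_zero fun s' _ => ?_))
    have := congrFun hf s'
    change _ = f s' at this
    rw [this, sub_self, mul_zero]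
  rw [hf']
  exact congrFun hf s

lemma Vtau_eq_sum_VtauState (hP : IsKernel P) (hγ : γ ∈ Set.Ico (0 : ℝ) 1) (hπ : IsPolicy π)
    (hρ : IsDist ρ) : Vtau γ τ P π ρ c = ∑ s, ρ s * VtauState γ τ P π c s := by
  have h := Vtau_sub_sum (τ := τ) hP hγ hπ hρ c (VtauState γ τ P π c)
  refine sub_eq_zero.1 (h.trans (Finset.sum_eq_zero fun s' _ => ?_))
  rw [VtauState_bellman hP hγ hπ, sub_self, mul_zero]

/-- Performance-difference lemma. -/
lemma Vval_sub_Vval (hP : IsKernel P) (hγ : γ ∈ Set.Ico (0 : ℝ) 1) (hπ : IsPolicy π)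
    {π' : S → A → ℝ} (hπ' : IsPolicy π') (hρ : IsDist ρ) :
    Vval γ P π ρ c - Vval γ P π' ρ c = ∑ s, occ γ P π ρ s *
      ∑ a, (π s a - π' s a) * backup γ P c (VtauState γ 0 P π' c) s a := by
  rw [← Vtau_zero (π := π'), Vtau_eq_sum_VtauState hP hγ hπ' hρ, Vval_sub_sum hP hγ hπ hρ]
  refine Finset.sum_congr rfl fun s _ => ?_
  congr 1
  have h := VtauState_bellman (c := c) (τ := 0) hP hγ hπ' s
  simp only [zero_mul, sub_zero] at h
  simp only [sub_mul, Finset.sum_sub_distrib]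
  rw [h]

omit [DecidableEq S] in
lemma Vtau_le (hP : IsKernel P) (hγ : γ ∈ Set.Ico (0 : ℝ) 1) (hπ : IsPolicy π)
    (hρ : IsDist ρ) [Nonempty A] (hτ : 0 ≤ τ) {C : ℝ} (hc : ∀ s a, c s a ≤ C) :
    Vtau γ τ P π ρ c ≤ (C + τ * Real.log (Fintype.card A)) / (1 - γ) := by
  rw [Vtau_eq_Vval hP hγ hπ hρ, ← Vval_const hP hγ hπ hρ]
  refine Vval_mono hP hγ hπ hρ fun s => ?_
  calc ∑ a, π s a * (c s a - τ * Real.log (π s a))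
      = ∑ a, π s a * c s a + τ * ∑ a, π s a * (-Real.log (π s a)) := by
        rw [Finset.mul_sum, ← Finset.sum_add_distrib]
        exact Finset.sum_congr rfl fun a _ => by ring
    _ ≤ ∑ a, π s a * C + τ * Real.log (Fintype.card A) :=
        add_le_add (Finset.sum_le_sum fun a _ => mul_le_mul_of_nonneg_left (hc s a) (hπ.1 s a))
          (mul_le_mul_of_nonneg_left (entropy_le_log_card (hπ.1 s) (hπ.2 s)) hτ)
    _ = _ := by simp only [← Finset.sum_mul, hπ.2, one_mul]

omit [DecidableEq S] in
lemma Vval_le_Vtau (hP : IsKernel P) (hγ : γ ∈ Set.Ico (0 : ℝ) 1) (hπ : IsPolicy π)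
    (hρ : IsDist ρ) (hτ : 0 ≤ τ) : Vval γ P π ρ c ≤ Vtau γ τ P π ρ c := by
  rw [Vtau_eq_Vval hP hγ hπ hρ]
  refine Vval_mono hP hγ hπ hρ fun s => ?_
  have h := mul_nonneg hτ (entropy_nonneg (hπ.1 s) (hπ.2 s))
  rw [Finset.mul_sum] at h
  rw [← sub_nonneg, ← Finset.sum_sub_distrib]
  refine h.trans (Finset.sum_le_sum fun a _ => le_of_eq (by ring))

omit [DecidableEq S] in
lemma le_Vval (hP : IsKernel P) (hγ : γ ∈ Set.Ico (0 : ℝ) 1) (hπ : IsPolicy π)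
    (hρ : IsDist ρ) {C : ℝ} (hc : ∀ s a, C ≤ c s a) : C / (1 - γ) ≤ Vval γ P π ρ c := by
  rw [← Vval_const hP hγ hπ hρ]
  exact Vval_mono hP hγ hπ hρ fun s =>
    Finset.sum_le_sum fun a _ => mul_le_mul_of_nonneg_left (hc s a) (hπ.1 s a)

omit [DecidableEq S] in
lemma Vval_le (hP : IsKernel P) (hγ : γ ∈ Set.Ico (0 : ℝ) 1) (hπ : IsPolicy π)
    (hρ : IsDist ρ) {C : ℝ} (hc : ∀ s a, c s a ≤ C) : Vval γ P π ρ c ≤ C / (1 - γ) := by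
  rw [← Vval_const hP hγ hπ hρ]
  exact Vval_mono hP hγ hπ hρ fun s =>
    Finset.sum_le_sum fun a _ => mul_le_mul_of_nonneg_left (hc s a) (hπ.1 s a)

omit [DecidableEq S] in
lemma Vtau_le_Vval_add (hP : IsKernel P) (hγ : γ ∈ Set.Ico (0 : ℝ) 1) (hπ : IsPolicy π)
    (hρ : IsDist ρ) [Nonempty A] (hτ : 0 ≤ τ) :
    Vtau γ τ P π ρ c ≤ Vval γ P π ρ c + τ * Real.log (Fintype.card A) / (1 - γ) := by
  have h := Vtau_le (c := fun _ _ => 0) hP hγ hπ hρ hτ (fun _ _ => le_rfl)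
  rw [zero_add, Vtau, Vval_const hP hγ hπ hρ, zero_div, zero_add] at h
  rw [Vtau]
  linarith

lemma backup_mem_Icc (hP : IsKernel P) (hγ : γ ∈ Set.Ico (0 : ℝ) 1) (hπ : IsPolicy π)
    (hc : ∀ s a, c s a ∈ Set.Icc (0 : ℝ) 1) (s : S) (a : A) :
    backup γ P c (VtauState γ 0 P π c) s a ∈ Set.Icc 0 (1 / (1 - γ)) := by
  have h1 : 0 < 1 - γ := sub_pos.2 hγ.2
  have hv : ∀ s, 0 ≤ VtauState γ 0 P π c s ∧ VtauState γ 0 P π c s ≤ 1 / (1 - γ) := by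
    intro s
    rw [VtauState, Vtau_zero]
    refine ⟨?_, Vval_le hP hγ hπ (isDist_diracS s) fun s a => (hc s a).2⟩
    simpa using le_Vval hP hγ hπ (isDist_diracS s) fun s a => (hc s a).1
  refine ⟨add_nonneg (hc s a).1 (mul_nonneg hγ.1 (Finset.sum_nonneg fun s' _ =>
    mul_nonneg (hP.1 _ _ _) (hv s').1)), ?_⟩
  have h2 := backup_le (c := c) (g := fun _ => 0) hP hγ (fun s => (hv s).2.trans (zero_add _).ge) s a
  have h3 : backup γ P c (fun _ => 0) s a = c s a := by simp [backup]
  rw [h3] at h2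
  have h4 : 1 + γ * (1 / (1 - γ)) = 1 / (1 - γ) := by field_simp; ring
  linarith [(hc s a).2]

/-- The fixed-point equation of the soft Bellman optimality operator. -/
def IsSoftOpt (γ τ : ℝ) (P : S → A → S → ℝ) (c : S → A → ℝ) (f : S → ℝ) : Prop :=
  ∀ s, f s = τ * Real.log (∑ a, Real.exp (backup γ P c f s a / τ))

omit [DecidableEq S] in
lemma exists_isSoftOpt [Nonempty A] (hP : IsKernel P) (hγ : γ ∈ Set.Ico (0 : ℝ) 1) (hτ : 0 < τ)
    (c : S → A → ℝ) : ∃ f, IsSoftOpt γ τ P c f := by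
  obtain ⟨f, hf⟩ := exists_fixed_point hγ
    (fun f s => τ * Real.log (∑ a, Real.exp (backup γ P c f s a / τ)))
    (fun f g e _ h s => log_sum_exp_le hτ (backup_le hP hγ h s))
  exact ⟨f, fun s => (congrFun hf s).symm⟩

/-- The greedy soft-max policy for a state function. -/
noncomputable def greedy (γ τ : ℝ) (P : S → A → S → ℝ) (c : S → A → ℝ) (f : S → ℝ) :
    S → A → ℝ := softmaxPol fun s a => backup γ P c f s a / τ

omit [DecidableEq S] in
lemma inSoftmax_greedy (f : S → ℝ) : InSoftmax (greedy γ τ P c f) := ⟨_, rfl⟩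

omit [DecidableEq S] in
lemma log_greedy [Nonempty A] (hτ : 0 < τ) (f : S → ℝ) (s : S) (a : A) :
    τ * Real.log (greedy γ τ P c f s a) =
      backup γ P c f s a - τ * Real.log (∑ a', Real.exp (backup γ P c f s a' / τ)) := by
  rw [greedy, log_softmaxPol, mul_sub, mul_div_cancel₀ _ hτ.ne']

omit [DecidableEq S] in
lemma softOpt_sub_Vtau [Nonempty A] (hP : IsKernel P) (hγ : γ ∈ Set.Ico (0 : ℝ) 1) (hτ : 0 < τ)
    (hπ : IsPolicy π) (hρ : IsDist ρ) {f : S → ℝ} (hf : IsSoftOpt γ τ P c f) :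
    ∑ s, ρ s * f s - Vtau γ τ P π ρ c = τ * ∑ s, occ γ P π ρ s *
      ∑ a, π s a * (Real.log (π s a) - Real.log (greedy γ τ P c f s a)) := by
  rw [← neg_sub, Vtau_sub_sum hP hγ hπ hρ, Finset.mul_sum, ← Finset.sum_neg_distrib]
  refine Finset.sum_congr rfl fun s _ => ?_
  have h : f s = ∑ a, π s a * f s := by rw [← Finset.sum_mul, hπ.2, one_mul]
  rw [← mul_neg, mul_left_comm, neg_sub]
  congr 1
  nth_rewrite 1 [h]
  rw [← Finset.sum_sub_distrib, Finset.mul_sum]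
  refine Finset.sum_congr rfl fun a _ => ?_
  have h1 := log_greedy (c := c) (P := P) (γ := γ) hτ f s a
  rw [← hf s] at h1
  linear_combination π s a * h1

omit [DecidableEq S] in
lemma Vtau_greedy_softOpt [Nonempty A] (hP : IsKernel P) (hγ : γ ∈ Set.Ico (0 : ℝ) 1)
    (hτ : 0 < τ) (hρ : IsDist ρ) {f : S → ℝ} (hf : IsSoftOpt γ τ P c f) :
    Vtau γ τ P (greedy γ τ P c f) ρ c = ∑ s, ρ s * f s := by
  have h := softOpt_sub_Vtau hP hγ hτ
    (inSoftmax_greedy (γ := γ) (τ := τ) (P := P) (c := c) f).isPolicy hρ hf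
  simp only [sub_self, mul_zero, Finset.sum_const_zero] at h
  linarith

lemma sq_Vval_sub_le_softOpt_gap [Nonempty A] (hP : IsKernel P) (hγ : γ ∈ Set.Ico (0 : ℝ) 1)
    (hτ : 0 < τ) (hπ : IsPolicy π) (hρ : IsDist ρ) {f : S → ℝ} (hf : IsSoftOpt γ τ P c f)
    {u : S → A → ℝ} (hu : ∀ s a, u s a ∈ Set.Icc (0 : ℝ) 1) :
    τ * (1 - γ) ^ 3 * (Vval γ P π ρ u - Vval γ P (greedy γ τ P c f) ρ u) ^ 2 ≤
      ∑ s, ρ s * f s - Vtau γ τ P π ρ c := by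
  have h1γ : 0 < 1 - γ := sub_pos.2 hγ.2
  have hq := inSoftmax_greedy (γ := γ) (τ := τ) (P := P) (c := c) f
  have hocc := occ_nonneg hP hγ hπ hρ
  rw [softOpt_sub_Vtau hP hγ hτ hπ hρ hf, Vval_sub_Vval hP hγ hπ hq.isPolicy hρ, mul_assoc]
  refine mul_le_mul_of_nonneg_left ?_ hτ.le
  have h1 : ∀ s, (∑ a, (π s a - greedy γ τ P c f s a) *
      backup γ P u (VtauState γ 0 P (greedy γ τ P c f) u) s a) ^ 2 ≤ (1 / (1 - γ)) ^ 2 *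
      ∑ a, π s a * (Real.log (π s a) - Real.log (greedy γ τ P c f s a)) := fun s =>
    sq_sum_sub_mul_le_kl (hπ.1 s) (hq.pos s) (hπ.2 s) (hq.isPolicy.2 s)
      (backup_mem_Icc hP hγ hq.isPolicy hu s)
  have h2 := Finset.sum_sq_le_sum_mul_sum_of_sq_le_mul Finset.univ
    (r := fun s => occ γ P π ρ s * ∑ a, (π s a - greedy γ τ P c f s a) *
      backup γ P u (VtauState γ 0 P (greedy γ τ P c f) u) s a)
    (f := fun s => occ γ P π ρ s)
    (g := fun s => occ γ P π ρ s * (∑ a, (π s a - greedy γ τ P c f s a) *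
      backup γ P u (VtauState γ 0 P (greedy γ τ P c f) u) s a) ^ 2)
    (fun s _ => hocc s) (fun s _ => mul_nonneg (hocc s) (sq_nonneg _))
    (fun s _ => le_of_eq (by ring))
  rw [sum_occ hP hγ hπ hρ] at h2
  have h3 := Finset.sum_le_sum fun s (_ : s ∈ Finset.univ) =>
    mul_le_mul_of_nonneg_left (h1 s) (hocc s)
  simp only [mul_left_comm _ ((1 / (1 - γ)) ^ 2), ← Finset.mul_sum] at h3
  have h4 := h2.trans (mul_le_mul_of_nonneg_left h3 (one_div_pos.2 h1γ).le)
  refine (mul_le_mul_of_nonneg_left h4 (pow_pos h1γ 3).le).trans (le_of_eq ?_)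
  field_simp

/-- With step size `(1-γ)/τ`, the natural policy gradient step is soft policy iteration. -/
lemma npgStep_eq_greedy (hγ : γ ∈ Set.Ico (0 : ℝ) 1) (hτ : 0 < τ) (c π : S → A → ℝ) :
    npgStep γ τ ((1 - γ) / τ) P c π = greedy γ τ P c (VtauState γ τ P π c) := by
  have h1γ : 1 - γ ≠ 0 := (sub_pos.2 hγ.2).ne'
  have h1 : 1 - (1 - γ) / τ * τ / (1 - γ) = 0 := by field_simp; ring
  have h2 : ∀ x : ℝ, (1 - γ) / τ * x / (1 - γ) = x / τ := fun x => by field_simp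
  funext s a
  simp only [npgStep, h1, Real.rpow_zero, one_mul]
  simp only [h2]
  rfl

lemma VtauState_le_softOpt [Nonempty A] (hP : IsKernel P) (hγ : γ ∈ Set.Ico (0 : ℝ) 1)
    (hτ : 0 < τ) (hπ : IsPolicy π) {f : S → ℝ} (hf : IsSoftOpt γ τ P c f) (s : S) :
    VtauState γ τ P π c s ≤ f s := by
  have h := softOpt_sub_Vtau hP hγ hτ hπ (isDist_diracS s) hf
  rw [sum_diracS_mul] at h
  have h2 : 0 ≤ f s - Vtau γ τ P π (diracS s) c := by
    rw [h]
    refine mul_nonneg hτ.le (Finset.sum_nonneg fun s' _ =>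
      mul_nonneg (occ_nonneg hP hγ hπ (isDist_diracS s) s') ?_)
    have hq := inSoftmax_greedy (γ := γ) (τ := τ) (P := P) (c := c) f
    exact kl_nonneg (hπ.1 s') (hq.pos s') (hπ.2 s') (hq.isPolicy.2 s')
  exact sub_nonneg.1 h2

/-- Soft policy iteration dominates one step of soft value iteration. -/
lemma le_VtauState_npgStep [Nonempty A] (hP : IsKernel P) (hγ : γ ∈ Set.Ico (0 : ℝ) 1)
    (hτ : 0 < τ) (hπ : IsPolicy π) (s : S) :
    τ * Real.log (∑ a, Real.exp (backup γ P c (VtauState γ τ P π c) s a / τ)) ≤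
      VtauState γ τ P (npgStep γ τ ((1 - γ) / τ) P c π) c s := by
  rw [npgStep_eq_greedy hγ hτ]
  set v := VtauState γ τ P π c with hv
  have hq := (inSoftmax_greedy (γ := γ) (τ := τ) (P := P) (c := c) v).isPolicy
  have hT : ∀ (f : S → ℝ) s, ∑ a, greedy γ τ P c v s a *
      (backup γ P c f s a - τ * Real.log (greedy γ τ P c v s a)) =
      τ * Real.log (∑ a, Real.exp (backup γ P c v s a / τ)) +
        ∑ a, greedy γ τ P c v s a * (backup γ P c f s a - backup γ P c v s a) := by
    intro f s
    have hZ : ∑ a, greedy γ τ P c v s a *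
        (τ * Real.log (∑ a, Real.exp (backup γ P c v s a / τ))) =
        τ * Real.log (∑ a, Real.exp (backup γ P c v s a / τ)) := by
      rw [← Finset.sum_mul, hq.2, one_mul]
    conv_rhs => rw [← hZ]
    rw [← Finset.sum_add_distrib]
    refine Finset.sum_congr rfl fun a _ => ?_
    rw [log_greedy hτ]
    ring
  have hle : ∀ s, v s ≤ τ * Real.log (∑ a, Real.exp (backup γ P c v s a / τ)) := by
    intro s
    rw [hv, ← VtauState_bellman hP hγ hπ s]
    exact gibbs_le hτ (hπ.1 s) (hπ.2 s) _
  have hmono : ∀ s, v s ≤ VtauState γ τ P (greedy γ τ P c v) c s := by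
    intro s
    have h := Vtau_sub_sum (τ := τ) hP hγ hq (isDist_diracS s) c v
    rw [sum_diracS_mul] at h
    rw [← sub_nonneg, VtauState, h]
    refine Finset.sum_nonneg fun s' _ =>
      mul_nonneg (occ_nonneg hP hγ hq (isDist_diracS s) s') ?_
    rw [hT]
    simpa using hle s'
  rw [← VtauState_bellman hP hγ hq s, hT, le_add_iff_nonneg_right]
  refine Finset.sum_nonneg fun a _ => mul_nonneg (hq.1 s a) ?_
  have := backup_le (c := c) (e := 0) hP hγ (fun s => by simpa using hmono s) s a
  linarith

lemma npg_iterate_inSoftmax (hγ : γ ∈ Set.Ico (0 : ℝ) 1) (hτ : 0 < τ)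
    (hπ : InSoftmax π) (N : ℕ) : InSoftmax ((npgStep γ τ ((1 - γ) / τ) P c)^[N] π) := by
  cases N with
  | zero => exact hπ
  | succ N =>
    rw [Function.iterate_succ_apply', npgStep_eq_greedy hγ hτ]
    exact inSoftmax_greedy _

lemma npg_iterate_gap [Nonempty A] (hP : IsKernel P) (hγ : γ ∈ Set.Ico (0 : ℝ) 1)
    (hτ : 0 < τ) (hπ : InSoftmax π) {f : S → ℝ} (hf : IsSoftOpt γ τ P c f) {e : ℝ}
    (he : ∀ s, f s ≤ VtauState γ τ P π c s + e) (N : ℕ) (s : S) :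
    f s ≤ VtauState γ τ P ((npgStep γ τ ((1 - γ) / τ) P c)^[N] π) c s + γ ^ N * e := by
  induction N generalizing s with
  | zero => simpa using he s
  | succ N ih =>
    rw [Function.iterate_succ_apply']
    have h1 := le_VtauState_npgStep (c := c) hP hγ hτ
      (npg_iterate_inSoftmax (P := P) (c := c) hγ hτ hπ N).isPolicy s
    have h2 := log_sum_exp_le hτ (backup_le (c := c) hP hγ ih s)
    rw [← hf s] at h2
    rw [pow_succ']
    linarith

/-- Linear convergence of the natural policy gradient method for bounded rewards. -/
lemma npg_gap [Nonempty A] (hP : IsKernel P) (hγ : γ ∈ Set.Ico (0 : ℝ) 1)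
    (hτ : 0 < τ) (hπ : InSoftmax π) (hρ : IsDist ρ) {f : S → ℝ} (hf : IsSoftOpt γ τ P c f)
    {C : ℝ} (hC : ∀ s a, |c s a| ≤ C) (N : ℕ) :
    ∑ s, ρ s * f s - Vtau γ τ P ((npgStep γ τ ((1 - γ) / τ) P c)^[N] π) ρ c ≤
      γ ^ N * ((2 * C + τ * Real.log (Fintype.card A)) / (1 - γ)) := by
  have he : ∀ s, f s ≤ VtauState γ τ P π c s +
      (2 * C + τ * Real.log (Fintype.card A)) / (1 - γ) := by
    intro s
    have h1 := Vtau_greedy_softOpt hP hγ hτ (isDist_diracS s) hf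
    rw [sum_diracS_mul] at h1
    have h2 := Vtau_le hP hγ (inSoftmax_greedy (γ := γ) (τ := τ) (P := P) (c := c) f).isPolicy
      (isDist_diracS s) hτ.le (fun s a => (abs_le.1 (hC s a)).2)
    have h3 := (le_Vval hP hγ hπ.isPolicy (isDist_diracS s)
      (fun s a => (abs_le.1 (hC s a)).1)).trans
        (Vval_le_Vtau hP hγ hπ.isPolicy (isDist_diracS s) hτ.le)
    rw [VtauState]
    have h4 : (2 * C + τ * Real.log (Fintype.card A)) / (1 - γ) =
      (C + τ * Real.log (Fintype.card A)) / (1 - γ) - (-C / (1 - γ)) := by ring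
    linarith
  have h := npg_iterate_gap hP hγ hτ hπ hf he N
  rw [Vtau_eq_sum_VtauState hP hγ (npg_iterate_inSoftmax hγ hτ hπ N).isPolicy hρ,
    ← Finset.sum_sub_distrib]
  calc _ ≤ ∑ s, ρ s * (γ ^ N * ((2 * C + τ * Real.log (Fintype.card A)) / (1 - γ))) := by
        refine Finset.sum_le_sum fun s _ => ?_
        rw [← mul_sub]
        exact mul_le_mul_of_nonneg_left (by linarith [h s]) (hρ.1 s)
    _ = _ := by rw [← Finset.sum_mul, hρ.2, one_mul]

end Bellman

section AcceleratedDescent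

variable {n : ℕ}

lemma clamp_variational {ℓ G y R x : ℝ} (hℓ : 0 < ℓ) (hx : 0 ≤ x) (hxR : x ≤ R) :
    G * (min R (max 0 (y - 1 / ℓ * G)) - x) + ℓ / 2 * (min R (max 0 (y - 1 / ℓ * G)) - y) ^ 2 ≤
      ℓ / 2 * ((y - x) ^ 2 - (min R (max 0 (y - 1 / ℓ * G)) - x) ^ 2) := by
  obtain ⟨z, rfl⟩ : ∃ z, G = ℓ * (y - z) := ⟨y - 1 / ℓ * G, by field_simp; ring⟩
  have h1 : y - 1 / ℓ * (ℓ * (y - z)) = z := by field_simp; ring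
  rw [h1]
  set p := min R (max 0 z) with hp
  have h2 : (p - z) * (p - x) ≤ 0 := by
    rcases le_total z 0 with hz | hz
    · rw [max_eq_left hz, min_eq_right (hx.trans hxR)] at hp
      rw [hp]
      nlinarith
    · rw [max_eq_right hz] at hp
      rcases le_total z R with hz' | hz'
      · rw [min_eq_right hz'] at hp
        rw [hp]
        simp
      · rw [min_eq_left hz'] at hp
        rw [hp]
        nlinarith
  nlinarith [mul_le_mul_of_nonneg_left h2 hℓ.le]

/-- Convergence of Nesterov-accelerated projected descent with an inexact first-order oracle. -/
lemma accelerated_descent_bound {D : (Fin n → ℝ) → ℝ} {ℓ δ : ℝ} {R s : Fin n → ℝ}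
    {lam mu G : ℕ → Fin n → ℝ} (hℓ : 0 < ℓ) (hδ : 0 ≤ δ) (hs : ∀ i, 0 ≤ s i ∧ s i ≤ R i)
    (h0 : ∀ i, 0 ≤ lam 0 i ∧ lam 0 i ≤ R i) (hbox : ∀ t i, 0 ≤ lam (t + 1) i ∧ lam (t + 1) i ≤ R i)
    (hmu : ∀ t : ℕ, mu t = fun i => lam (t + 1) i + (((t : ℝ) - 1) / ((t : ℝ) + 2)) *
      (lam (t + 1) i - lam t i))
    (hlam : ∀ t : ℕ, lam (t + 2) = fun i => min (R i) (max 0 (mu t i - 1 / ℓ * G t i)))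
    (horacle : ∀ t x y, D y - D x ≤
      ∑ i, G t i * (y i - x i) + ℓ / 2 * ∑ i, (y i - mu t i) ^ 2 + δ)
    (hmin : ∀ x : Fin n → ℝ, (∀ i, 0 ≤ x i) → D s ≤ D x) (T : ℕ) :
    ((T : ℝ) ^ 2 + 2 * T) / 4 * (D (lam (T + 1)) - D s) ≤
      ℓ / 2 * ∑ i, R i ^ 2 + T * (((T : ℝ) + 1) / 2) ^ 2 * δ := by
  have hstep : ∀ t x, (∀ i, 0 ≤ x i ∧ x i ≤ R i) → D (lam (t + 2)) - D x ≤
      ℓ / 2 * ∑ i, ((mu t i - x i) ^ 2 - (lam (t + 2) i - x i) ^ 2) + δ := by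
    intro t x hx
    refine (horacle t x _).trans (add_le_add_left ?_ _)
    rw [Finset.mul_sum, Finset.mul_sum, ← Finset.sum_add_distrib]
    refine Finset.sum_le_sum fun i _ => ?_
    rw [hlam t]
    exact clamp_variational hℓ (hx i).1 (hx i).2
  have hpot : ((T : ℝ) ^ 2 + 2 * T) / 4 * (D (lam (T + 1)) - D s) +
      ℓ / 2 * ∑ i, (((T : ℝ) + 1) / 2 * lam (T + 1) i - ((T : ℝ) - 1) / 2 * lam T i - s i) ^ 2 ≤
      ℓ / 2 * ∑ i, R i ^ 2 + T * (((T : ℝ) + 1) / 2) ^ 2 * δ := by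
    induction T with
    | zero =>
      have h1 : ∑ i, (((0 : ℝ) + 1) / 2 * lam 1 i - ((0 : ℝ) - 1) / 2 * lam 0 i - s i) ^ 2 ≤
          ∑ i, R i ^ 2 := by
        refine Finset.sum_le_sum fun i _ => ?_
        have := hs i
        have := h0 i
        have := hbox 0 i
        rw [zero_add] at this
        refine sq_le_sq' ?_ ?_ <;> linarith
      simpa using mul_le_mul_of_nonneg_left h1 (half_pos hℓ).le
    | succ t ih =>
      have ht : (0 : ℝ) ≤ t := Nat.cast_nonneg t
      have ha := hstep t (lam (t + 1)) (hbox t)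
      have hb := hstep t s hs
      have hv : 0 ≤ D (lam (t + 2)) - D s :=
        sub_nonneg.2 (hmin _ fun i => (hbox (t + 1) i).1)
      have ha' := mul_le_mul_of_nonneg_left ha
        (show 0 ≤ ((t : ℝ) ^ 2 + 2 * t) / 4 by positivity)
      have hb' := mul_le_mul_of_nonneg_left hb (show 0 ≤ ((t : ℝ) + 2) / 2 by positivity)
      have hid : ((t : ℝ) ^ 2 + 2 * t) / 4 *
            ∑ i, ((mu t i - lam (t + 1) i) ^ 2 - (lam (t + 2) i - lam (t + 1) i) ^ 2) +
          ((t : ℝ) + 2) / 2 * ∑ i, ((mu t i - s i) ^ 2 - (lam (t + 2) i - s i) ^ 2) =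
          ∑ i, (((t : ℝ) + 1) / 2 * lam (t + 1) i - ((t : ℝ) - 1) / 2 * lam t i - s i) ^ 2 -
          ∑ i, (((t : ℝ) + 1 + 1) / 2 * lam (t + 2) i - ((t : ℝ) + 1 - 1) / 2 * lam (t + 1) i
            - s i) ^ 2 := by
        rw [Finset.mul_sum, Finset.mul_sum, ← Finset.sum_add_distrib, ← Finset.sum_sub_distrib]
        refine Finset.sum_congr rfl fun i _ => ?_
        have h2 : ((t : ℝ) + 1) / 2 * lam (t + 1) i - ((t : ℝ) - 1) / 2 * lam t i =
            ((t : ℝ) + 2) / 2 * mu t i - (t : ℝ) / 2 * lam (t + 1) i := by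
          rw [hmu t]
          field_simp
          ring
        rw [h2]
        ring
      push_cast
      have h3 := congrArg (fun z => ℓ / 2 * z) hid
      simp only [mul_add, mul_sub] at h3
      have h4 : (t : ℝ) * (((t : ℝ) + 1) / 2) ^ 2 * δ + (((t : ℝ) + 2) / 2) ^ 2 * δ ≤
          ((t : ℝ) + 1) * (((t : ℝ) + 1 + 1) / 2) ^ 2 * δ := by
        rw [← add_mul]
        refine mul_le_mul_of_nonneg_right ?_ hδ
        nlinarith
      have h5 : (((t : ℝ) + 1) ^ 2 + 2 * ((t : ℝ) + 1)) / 4 * (D (lam (t + 2)) - D s) ≤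
          (((t : ℝ) + 2) / 2) ^ 2 * (D (lam (t + 2)) - D s) := by
        refine mul_le_mul_of_nonneg_right ?_ hv
        nlinarith
      change _ * (D (lam (t + 2)) - D s) + ℓ / 2 * ∑ i, (_ * lam (t + 2) i - _ - _) ^ 2 ≤ _
      linarith
  have h6 : 0 ≤ ∑ i, (((T : ℝ) + 1) / 2 * lam (T + 1) i - ((T : ℝ) - 1) / 2 * lam T i - s i) ^ 2 :=
    Finset.sum_nonneg fun _ _ => sq_nonneg _
  nlinarith [mul_nonneg (half_pos hℓ).le h6]

end AcceleratedDescent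

section DualFunction

variable {S A : Type} [Fintype S] [Fintype A] {γ τ : ℝ} {P : S → A → S → ℝ} {π : S → A → ℝ}
  {ρ : S → ℝ} {r : S → A → ℝ} {n : ℕ} {g : Fin n → S → A → ℝ} {b : Fin n → ℝ}

lemma Vval_rLam (hP : IsKernel P) (hγ : γ ∈ Set.Ico (0 : ℝ) 1) (hπ : IsPolicy π)
    (hρ : IsDist ρ) (ν : Fin n → ℝ) :
    Vval γ P π ρ (rLam r g ν) = Vval γ P π ρ r + ∑ i, ν i * Vval γ P π ρ (g i) := by
  simp only [Vval_eq_sum_occ hP hγ hπ hρ, rLam, Finset.mul_sum]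
  rw [Finset.sum_comm (s := (Finset.univ : Finset (Fin n))), ← Finset.sum_add_distrib]
  refine Finset.sum_congr rfl fun s _ => ?_
  rw [Finset.sum_comm (s := (Finset.univ : Finset (Fin n))), ← Finset.sum_add_distrib]
  refine Finset.sum_congr rfl fun a _ => ?_
  rw [mul_add, mul_add, Finset.mul_sum, Finset.mul_sum]
  congr 1
  exact Finset.sum_congr rfl fun i _ => by ring

lemma Lag_eq (hP : IsKernel P) (hγ : γ ∈ Set.Ico (0 : ℝ) 1) (hπ : IsPolicy π)
    (hρ : IsDist ρ) (ν : Fin n → ℝ) :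
    Lag γ τ P ρ r g b π ν = Vtau γ τ P π ρ (rLam r g ν) - ∑ i, ν i * b i := by
  simp only [Lag, Vtau, Vval_rLam hP hγ hπ hρ, mul_sub, Finset.sum_sub_distrib]
  ring

lemma Lag_sub_Lag (π : S → A → ℝ) (x y : Fin n → ℝ) :
    Lag γ τ P ρ r g b π y - Lag γ τ P ρ r g b π x =
      ∑ i, (Vval γ P π ρ (g i) - b i) * (y i - x i) := by
  rw [Lag, Lag, add_sub_add_left_eq_sub, ← Finset.sum_sub_distrib]
  exact Finset.sum_congr rfl fun i _ => by ring

variable [Nonempty A] [DecidableEq S]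

omit [DecidableEq S] in
lemma Lag_greedy_eq (hP : IsKernel P) (hγ : γ ∈ Set.Ico (0 : ℝ) 1) (hτ : 0 < τ)
    (hρ : IsDist ρ) {ν : Fin n → ℝ} {f : S → ℝ} (hf : IsSoftOpt γ τ P (rLam r g ν) f) :
    Lag γ τ P ρ r g b (greedy γ τ P (rLam r g ν) f) ν = ∑ s, ρ s * f s - ∑ i, ν i * b i := by
  rw [Lag_eq hP hγ (inSoftmax_greedy f).isPolicy hρ, Vtau_greedy_softOpt hP hγ hτ hρ hf]

lemma Dual_eq (hP : IsKernel P) (hγ : γ ∈ Set.Ico (0 : ℝ) 1) (hτ : 0 < τ)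
    (hρ : IsDist ρ) {ν : Fin n → ℝ} {f : S → ℝ} (hf : IsSoftOpt γ τ P (rLam r g ν) f) :
    Dual γ τ P ρ r g b ν = ∑ s, ρ s * f s - ∑ i, ν i * b i := by
  refine IsGreatest.csSup_eq ⟨⟨_, inSoftmax_greedy f, Lag_greedy_eq hP hγ hτ hρ hf⟩, ?_⟩
  rintro _ ⟨π, hπ, rfl⟩
  simp only
  rw [Lag_eq hP hγ hπ.isPolicy hρ, Vtau_eq_sum_VtauState hP hγ hπ.isPolicy hρ]
  refine sub_le_sub_right (Finset.sum_le_sum fun s _ => mul_le_mul_of_nonneg_left ?_ (hρ.1 s)) _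
  exact VtauState_le_softOpt hP hγ hτ hπ.isPolicy hf s

/-- Existence of the Lagrangian maximizer, with quadratic growth measured by bounded utilities. -/
lemma exists_dual_maximizer (hP : IsKernel P) (hγ : γ ∈ Set.Ico (0 : ℝ) 1) (hτ : 0 < τ)
    (hρ : IsDist ρ) (r : S → A → ℝ) (g : Fin n → S → A → ℝ) (b ν : Fin n → ℝ) :
    ∃ q, InSoftmax q ∧ Lag γ τ P ρ r g b q ν = Dual γ τ P ρ r g b ν ∧
      ∀ π, IsPolicy π → ∀ u : S → A → ℝ, (∀ s a, u s a ∈ Set.Icc (0 : ℝ) 1) →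
        τ * (1 - γ) ^ 3 * (Vval γ P π ρ u - Vval γ P q ρ u) ^ 2 ≤
          Dual γ τ P ρ r g b ν - Lag γ τ P ρ r g b π ν := by
  obtain ⟨f, hf⟩ := exists_isSoftOpt hP hγ hτ (rLam r g ν)
  refine ⟨greedy γ τ P (rLam r g ν) f, inSoftmax_greedy f, ?_, fun π hπ u hu => ?_⟩
  · rw [Lag_greedy_eq hP hγ hτ hρ hf, Dual_eq hP hγ hτ hρ hf]
  · rw [Lag_eq hP hγ hπ hρ, Dual_eq hP hγ hτ hρ hf, sub_sub_sub_cancel_right]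
    exact sq_Vval_sub_le_softOpt_gap hP hγ hτ hπ hρ hf hu

lemma Lag_le_Dual (hP : IsKernel P) (hγ : γ ∈ Set.Ico (0 : ℝ) 1) (hτ : 0 < τ)
    (hπ : IsPolicy π) (hρ : IsDist ρ) (ν : Fin n → ℝ) :
    Lag γ τ P ρ r g b π ν ≤ Dual γ τ P ρ r g b ν := by
  obtain ⟨q, -, -, h⟩ := exists_dual_maximizer hP hγ hτ hρ r g b ν
  have h1 := h π hπ (fun _ _ => 0) (fun _ _ => by simp)
  have h2 : 0 ≤ τ * (1 - γ) ^ 3 := mul_nonneg hτ.le (pow_nonneg (sub_nonneg.2 hγ.2.le) 3)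
  linarith [mul_nonneg h2 (sq_nonneg
    (Vval γ P π ρ (fun _ _ => 0) - Vval γ P q ρ (fun _ _ => 0)))]

lemma npg_dual_gap (hP : IsKernel P) (hγ : γ ∈ Set.Ico (0 : ℝ) 1) (hτ : 0 < τ)
    (hπ : InSoftmax π) (hρ : IsDist ρ) {ν : Fin n → ℝ} {C : ℝ}
    (hC : ∀ s a, |rLam r g ν s a| ≤ C) (N : ℕ) :
    Dual γ τ P ρ r g b ν -
        Lag γ τ P ρ r g b ((npgStep γ τ ((1 - γ) / τ) P (rLam r g ν))^[N] π) ν ≤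
      γ ^ N * ((2 * C + τ * Real.log (Fintype.card A)) / (1 - γ)) := by
  obtain ⟨f, hf⟩ := exists_isSoftOpt hP hγ hτ (rLam r g ν)
  rw [Lag_eq hP hγ (npg_iterate_inSoftmax hγ hτ hπ N).isPolicy hρ, Dual_eq hP hγ hτ hρ hf,
    sub_sub_sub_cancel_right]
  exact npg_gap hP hγ hτ hπ hρ hf hC N

/-- An approximate Lagrangian maximizer gives an inexact first-order oracle for the dual. -/
lemma dual_inexact_oracle (hP : IsKernel P) (hγ : γ ∈ Set.Ico (0 : ℝ) 1) (hτ : 0 < τ)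
    (hπ : IsPolicy π) (hρ : IsDist ρ) (hn : 0 < n)
    (hg : ∀ i s a, g i s a ∈ Set.Icc (0 : ℝ) 1) {m : Fin n → ℝ} {δ : ℝ}
    (hδ : Dual γ τ P ρ r g b m - Lag γ τ P ρ r g b π m ≤ δ) (x y : Fin n → ℝ) :
    Dual γ τ P ρ r g b y - Dual γ τ P ρ r g b x ≤
      ∑ i, (Vval γ P π ρ (g i) - b i) * (y i - x i) +
        n / (2 * (τ * (1 - γ) ^ 3)) * ∑ i, (y i - m i) ^ 2 + 2 * δ := by
  obtain ⟨qy, hqy, hqyD, -⟩ := exists_dual_maximizer hP hγ hτ hρ r g b y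
  obtain ⟨qm, hqm, hqmD, hgrow⟩ := exists_dual_maximizer hP hγ hτ hρ r g b m
  set κ := τ * (1 - γ) ^ 3 with hκ
  have hκ0 : 0 < κ := mul_pos hτ (pow_pos (sub_pos.2 hγ.2) 3)
  have hn' : (0 : ℝ) < n := by exact_mod_cast hn
  have hgrow' : ∀ π', IsPolicy π' →
      κ / n * ∑ i, (Vval γ P π' ρ (g i) - Vval γ P qm ρ (g i)) ^ 2 ≤
        Dual γ τ P ρ r g b m - Lag γ τ P ρ r g b π' m := by
    intro π' hπ'
    have h := Finset.sum_le_sum fun i (_ : i ∈ Finset.univ) => hgrow π' hπ' (g i) (hg i)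
    rw [← Finset.mul_sum, Finset.sum_const, Finset.card_univ, Fintype.card_fin, nsmul_eq_mul] at h
    rw [div_mul_eq_mul_div, div_le_iff₀ hn']
    linarith
  have hyoung : ∀ u z : ℝ, u * z ≤ κ / n * u ^ 2 + n / (4 * κ) * z ^ 2 := by
    intro u z
    have h1 : κ / n * u ^ 2 + n / (4 * κ) * z ^ 2 - u * z =
        (2 * κ * u - n * z) ^ 2 / (4 * κ * n) := by
      field_simp
      ring
    have h2 : 0 ≤ (2 * κ * u - n * z) ^ 2 / (4 * κ * n) := by positivity
    linarith
  have h1 : ∑ i, (Vval γ P qy ρ (g i) - Vval γ P qm ρ (g i)) * (y i - m i) ≤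
      κ / n * ∑ i, (Vval γ P qy ρ (g i) - Vval γ P qm ρ (g i)) ^ 2 +
        n / (4 * κ) * ∑ i, (y i - m i) ^ 2 := by
    rw [Finset.mul_sum, Finset.mul_sum, ← Finset.sum_add_distrib]
    exact Finset.sum_le_sum fun i _ => hyoung _ _
  have h2 : ∑ i, (Vval γ P π ρ (g i) - Vval γ P qm ρ (g i)) * (m i - y i) ≤
      κ / n * ∑ i, (Vval γ P π ρ (g i) - Vval γ P qm ρ (g i)) ^ 2 +
        n / (4 * κ) * ∑ i, (y i - m i) ^ 2 := by
    rw [Finset.mul_sum, Finset.mul_sum, ← Finset.sum_add_distrib]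
    refine Finset.sum_le_sum fun i _ => (hyoung _ _).trans (le_of_eq ?_)
    ring
  have h3 := hgrow' qy hqy.isPolicy
  have h4 := hgrow' π hπ
  have h5 := Lag_le_Dual (r := r) (g := g) (b := b) hP hγ hτ hπ hρ x
  have h6 := Lag_sub_Lag (γ := γ) (τ := τ) (P := P) (ρ := ρ) (r := r) (g := g) (b := b) π x y
  have h7 := Lag_sub_Lag (γ := γ) (τ := τ) (P := P) (ρ := ρ) (r := r) (g := g) (b := b) qy m y
  have h8 := Lag_sub_Lag (γ := γ) (τ := τ) (P := P) (ρ := ρ) (r := r) (g := g) (b := b) π m y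
  have h9 : ∑ i, (Vval γ P qy ρ (g i) - b i) * (y i - m i) -
      ∑ i, (Vval γ P π ρ (g i) - b i) * (y i - m i) =
      ∑ i, (Vval γ P qy ρ (g i) - Vval γ P qm ρ (g i)) * (y i - m i) +
      ∑ i, (Vval γ P π ρ (g i) - Vval γ P qm ρ (g i)) * (m i - y i) := by
    rw [← Finset.sum_sub_distrib, ← Finset.sum_add_distrib]
    exact Finset.sum_congr rfl fun i _ => by ring
  have h10 : (n : ℝ) / (2 * κ) * ∑ i, (y i - m i) ^ 2 =
      n / (4 * κ) * ∑ i, (y i - m i) ^ 2 + n / (4 * κ) * ∑ i, (y i - m i) ^ 2 := by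
    field_simp
    ring
  linarith

lemma abs_rLam_le {S A : Type} {r : S → A → ℝ} {n : ℕ} {g : Fin n → S → A → ℝ}
    (hr : ∀ s a, r s a ∈ Set.Icc (0 : ℝ) 1) (hg : ∀ i s a, g i s a ∈ Set.Icc (0 : ℝ) 1)
    {ν B : Fin n → ℝ} (hν : ∀ i, |ν i| ≤ B i) (s : S) (a : A) :
    |rLam r g ν s a| ≤ 1 + ∑ i, B i := by
  refine (abs_add_le _ _).trans (add_le_add ?_ ((Finset.abs_sum_le_sum_abs _ _).trans
    (Finset.sum_le_sum fun i _ => ?_)))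
  · rw [abs_of_nonneg (hr s a).1]
    exact (hr s a).2
  · rw [abs_mul, abs_of_nonneg (hg i s a).1]
    exact (mul_le_of_le_one_right (abs_nonneg _) (hg i s a).2).trans (hν i)

end DualFunction

/-- Iteration counts realizing the `O(ε⁻² log ε⁻¹)` budget. -/
lemma exists_iteration_counts {γ ε : ℝ} (hγ : γ ∈ Set.Ico (0 : ℝ) 1) (hε : 0 < ε)
    (hε' : ε ≤ 1 / 2) :
    ∃ T N : ℕ, 1 / ε ^ 2 ≤ T ∧ (T : ℝ) ≤ 2 / ε ^ 2 ∧ γ ^ N ≤ ε ^ 5 ∧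
      ((T * N + N : ℕ) : ℝ) ≤ 21 / (1 - γ) * (1 / ε ^ 2) * Real.log (1 / ε) := by
  have h1γ : 0 < 1 - γ := sub_pos.2 hγ.2
  have hlog : 1 / 2 ≤ Real.log (1 / ε) := by
    have h1 : (2 : ℝ) ≤ 1 / ε := by rw [le_div_iff₀ hε]; linarith
    have h2 := Real.log_le_log (by norm_num) h1
    linarith [Real.log_two_gt_d9]
  have hinv : 1 ≤ 1 / ε ^ 2 := by
    rw [le_div_iff₀ (by positivity)]
    nlinarith
  have hT := Nat.ceil_lt_add_one (show 0 ≤ 1 / ε ^ 2 by positivity)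
  have hN := Nat.ceil_lt_add_one (show 0 ≤ 5 * Real.log (1 / ε) / (1 - γ) by positivity)
  have hTle := Nat.le_ceil (1 / ε ^ 2)
  have hNle := Nat.le_ceil (5 * Real.log (1 / ε) / (1 - γ))
  set T := ⌈1 / ε ^ 2⌉₊
  set N := ⌈5 * Real.log (1 / ε) / (1 - γ)⌉₊
  have hT2 : (T : ℝ) ≤ 2 / ε ^ 2 := by
    have : 2 / ε ^ 2 = 1 / ε ^ 2 + 1 / ε ^ 2 := by ring
    linarith
  refine ⟨T, N, hTle, hT2, ?_, ?_⟩
  · rw [div_le_iff₀ h1γ, one_div, Real.log_inv] at hNle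
    calc γ ^ N ≤ Real.exp (-(1 - γ)) ^ N :=
          pow_le_pow_left₀ hγ.1 (by linarith [Real.add_one_le_exp (-(1 - γ))]) N
      _ = Real.exp (N * (-(1 - γ))) := (Real.exp_nat_mul _ _).symm
      _ ≤ Real.exp ((5 : ℕ) * Real.log ε) := Real.exp_le_exp.2 (by push_cast; linarith)
      _ = ε ^ 5 := by rw [Real.exp_nat_mul, Real.exp_log hε]
  · have hN2 : (N : ℝ) ≤ 7 / (1 - γ) * Real.log (1 / ε) := by
      have h1 : 2 * Real.log (1 / ε) ≤ 2 * Real.log (1 / ε) / (1 - γ) := by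
        rw [le_div_iff₀ h1γ]
        nlinarith [hγ.1]
      have h2 : 7 / (1 - γ) * Real.log (1 / ε) =
          5 * Real.log (1 / ε) / (1 - γ) + 2 * Real.log (1 / ε) / (1 - γ) := by ring
      linarith
    have hT3 : (T : ℝ) + 1 ≤ 3 / ε ^ 2 := by
      have : 3 / ε ^ 2 = 2 / ε ^ 2 + 1 / ε ^ 2 := by ring
      linarith
    push_cast
    calc (T : ℝ) * N + N = (T + 1) * N := by ring
      _ ≤ 3 / ε ^ 2 * (7 / (1 - γ) * Real.log (1 / ε)) :=
          mul_le_mul hT3 hN2 (Nat.cast_nonneg _) (by positivity)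
      _ = _ := by ring


lemma dual_gap_rate {ε Cl τ₀ R₂ e₀ v p : ℝ} {T : ℕ} (hε : 0 < ε) (hCl : 0 ≤ Cl) (hτ : 0 < τ₀)
    (hR : 0 ≤ R₂) (he : 0 ≤ e₀) (hT : 1 / ε ^ 2 ≤ T) (hT' : (T : ℝ) ≤ 2 / ε ^ 2)
    (hε' : ε ≤ 1 / 2) (hp : p ≤ ε ^ 5)
    (h : ((T : ℝ) ^ 2 + 2 * T) / 4 * v ≤
      Cl / (τ₀ * ε) / 2 * R₂ + T * (((T : ℝ) + 1) / 2) ^ 2 * (2 * (p * e₀))) :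
    v ≤ (2 * (Cl / τ₀) * R₂ + 16 * e₀) * ε ^ 3 := by
  have hK : 0 ≤ Cl / τ₀ * R₂ := mul_nonneg (div_nonneg hCl hτ.le) hR
  rcases le_total v 0 with hv | hv
  · refine hv.trans (mul_nonneg ?_ (pow_nonneg hε.le 3))
    linarith
  have hε2 : 0 < ε ^ 2 := pow_pos hε 2
  have hε1 : ε ^ 2 ≤ 1 := by nlinarith
  rw [div_le_iff₀ hε2] at hT
  rw [le_div_iff₀ hε2] at hT'
  have hT0 : (0 : ℝ) ≤ T := Nat.cast_nonneg T
  have hT1 : (1 : ℝ) ≤ T := by nlinarith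
  have h1 : (T : ℝ) ^ 2 / 4 * v ≤ Cl / (τ₀ * ε) / 2 * R₂ + T ^ 3 * (2 * (ε ^ 5 * e₀)) := by
    calc (T : ℝ) ^ 2 / 4 * v ≤ ((T : ℝ) ^ 2 + 2 * T) / 4 * v :=
          mul_le_mul_of_nonneg_right (by linarith) hv
      _ ≤ _ := h
      _ ≤ Cl / (τ₀ * ε) / 2 * R₂ + T * (((T : ℝ) + 1) / 2) ^ 2 * (2 * (ε ^ 5 * e₀)) := by
          gcongr
      _ ≤ Cl / (τ₀ * ε) / 2 * R₂ + T * (T : ℝ) ^ 2 * (2 * (ε ^ 5 * e₀)) := by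
          gcongr
          linarith
      _ = _ := by ring
  set x : ℝ := T * ε ^ 2 with hx
  have h2 : x ^ 2 / 4 * v ≤ (Cl / τ₀ * R₂) / 2 * ε ^ 3 + 2 * x ^ 3 * ε ^ 3 * e₀ := by
    have h3 := mul_le_mul_of_nonneg_right h1 (pow_nonneg hε.le 4)
    have h4 : (Cl / (τ₀ * ε) / 2 * R₂) * ε ^ 4 = (Cl / τ₀ * R₂) / 2 * ε ^ 3 := by
      field_simp
    rw [add_mul, h4] at h3
    calc x ^ 2 / 4 * v = (T : ℝ) ^ 2 / 4 * v * ε ^ 4 := by rw [hx]; ring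
      _ ≤ _ := h3
      _ = _ := by rw [hx]; ring
  have hx2 : 0 < x ^ 2 := by positivity
  have hx1 : 1 ≤ x ^ 2 := by nlinarith
  have hε3 : 0 ≤ ε ^ 3 := pow_nonneg hε.le 3
  have h5 : (Cl / τ₀ * R₂) / 2 * ε ^ 3 ≤ x ^ 2 * ((Cl / τ₀ * R₂) / 2 * ε ^ 3) :=
    le_mul_of_one_le_left (by positivity) hx1
  have h6 : 2 * x ^ 3 * ε ^ 3 * e₀ ≤ x ^ 2 * (4 * ε ^ 3 * e₀) := by
    have : x * (2 * x ^ 2 * ε ^ 3 * e₀) ≤ 2 * (2 * x ^ 2 * ε ^ 3 * e₀) :=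
      mul_le_mul_of_nonneg_right hT' (by positivity)
    linarith
  have h7 : x ^ 2 * (v / 4) ≤ x ^ 2 * ((Cl / τ₀ * R₂) / 2 * ε ^ 3 + 4 * ε ^ 3 * e₀) := by
    linarith
  linarith [le_of_mul_le_mul_left h7 hx2]

lemma abs_le_sqrt_div_mul {κ ε K z : ℝ} (hκ : 0 < κ) (hε : 0 < ε)
    (h : κ * ε * z ^ 2 ≤ K * ε ^ 3) : |z| ≤ √(K / κ) * ε := by
  have h1 : z ^ 2 ≤ K / κ * ε ^ 2 := by
    rw [div_mul_eq_mul_div, le_div_iff₀ hκ]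
    refine le_of_mul_le_mul_left ?_ hε
    linarith
  calc |z| ≤ √(K / κ * ε ^ 2) := Real.abs_le_sqrt h1
    _ = √(K / κ) * ε := by rw [Real.sqrt_mul' _ (sq_nonneg ε), Real.sqrt_sq hε.le]

lemma smoothness_constant_le {κ n a d w : ℝ} (hκ : 0 < κ) (hn : 0 ≤ n) (ha : 1 ≤ a)
    (hd : 0 < d) (hd' : d ≤ 1) (hw : 0 ≤ w) :
    n / (2 * κ) ≤ 2 * Real.log 2 * (n * a + w) / (κ * d) / 2 := by
  have hlog := Real.log_two_gt_d9
  have h1 : n ≤ n * a + w := by nlinarith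
  have h2 : n ≤ 2 * Real.log 2 * (n * a + w) := by nlinarith
  rw [div_div, div_le_div_iff₀ (by positivity) (by positivity)]
  have h3 : n * d ≤ 2 * Real.log 2 * (n * a + w) := by nlinarith
  nlinarith

lemma abs_extrapolation_le {x y R : ℝ} (hx : 0 ≤ x ∧ x ≤ R) (hy : 0 ≤ y ∧ y ≤ R) (t : ℕ) :
    |x + ((t : ℝ) - 1) / ((t : ℝ) + 2) * (x - y)| ≤ 2 * R := by
  have ht : (0 : ℝ) < (t : ℝ) + 2 := by positivity
  have ht0 : (0 : ℝ) ≤ t := Nat.cast_nonneg t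
  have hβ : |((t : ℝ) - 1) / ((t : ℝ) + 2)| ≤ 1 := by
    rw [abs_le, le_div_iff₀ ht, div_le_iff₀ ht]
    constructor <;> linarith
  have hxy : |x - y| ≤ R := abs_le.2 ⟨by linarith, by linarith⟩
  calc _ ≤ |x| + |((t : ℝ) - 1) / ((t : ℝ) + 2)| * |x - y| := by
        rw [← abs_mul]; exact abs_add_le _ _
    _ ≤ R + 1 * R := by
        gcongr
        exact abs_le.2 ⟨by linarith, hx.2⟩
    _ = 2 * R := by ring

/-- Corollary 1: under the Slater, strong duality and exploration
assumptions, with `τ = (1−γ)·ε/(4·log|A|)`, Algorithm 1 computes within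
`Õ(1/ε²) = O((1/ε²)·log(1/ε))` total NPG iterations a policy `π` for the standard CMDP
with `|V^{π*}(ρ) − V^π(ρ)| = O(ε)` and `max_i [b_i − U_{g_i}^π(ρ)]₊ = O(ε)`. -/
theorem accelerated_dual_descent_unregularized
    {S A : Type} [Fintype S] [Fintype A] [DecidableEq S]
    (P : S → A → S → ℝ) (r : S → A → ℝ) (γ : ℝ) (ρ : S → ℝ) {n : ℕ}
    (g : Fin n → S → A → ℝ) (b : Fin n → ℝ)
    (hP : IsKernel P) (hr : ∀ s a, r s a ∈ Set.Icc (0 : ℝ) 1)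
    (hγ : γ ∈ Set.Ico (0 : ℝ) 1) (hρ : IsDist ρ) (hn : 0 < n)
    (hA : 1 < Fintype.card A)
    (hg : ∀ i s a, g i s a ∈ Set.Icc (0 : ℝ) 1)
    (hb : ∀ i, b i ∈ Set.Icc (0 : ℝ) (1 / (1 - γ)))
    -- Slater condition
    (πbar : S → A → ℝ) (hbar : InSoftmax πbar) (ξ : Fin n → ℝ) (hξ : ∀ i, 0 < ξ i)
    (hslater : ∀ i, Vval γ P πbar ρ (g i) - b i ≥ ξ i)
    -- exploration assumption
    (d : ℝ) (hd : 0 < d)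
    (hexp : ∀ π : S → A → ℝ, InSoftmax π → ∀ s, d ≤ visit γ P π ρ s)
    -- strong duality for every regularization weight `τ > 0`
    (hsdall : ∀ τ : ℝ, 0 < τ → ∃ (πstar : S → A → ℝ) (lamstar : Fin n → ℝ),
      InSoftmax πstar ∧ (∀ i, Vval γ P πstar ρ (g i) ≥ b i) ∧
      (∀ π : S → A → ℝ, InSoftmax π → (∀ i, Vval γ P π ρ (g i) ≥ b i) →
        Vtau γ τ P π ρ r ≤ Vtau γ τ P πstar ρ r) ∧
      (∀ i, 0 ≤ lamstar i) ∧
      (∀ μ : Fin n → ℝ, (∀ i, 0 ≤ μ i) →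
        Dual γ τ P ρ r g b lamstar ≤ Dual γ τ P ρ r g b μ) ∧
      Vtau γ τ P πstar ρ r = Dual γ τ P ρ r g b lamstar ∧
      Dual γ τ P ρ r g b lamstar = Lag γ τ P ρ r g b πstar lamstar)
    -- `π*` is an optimal policy of the standard (unregularized) CMDP
    (πstd : S → A → ℝ) (hstd : IsPolicy πstd)
    (hstdfeas : ∀ i, Vval γ P πstd ρ (g i) ≥ b i)
    (hstdopt : ∀ π : S → A → ℝ, IsPolicy π → (∀ i, Vval γ P π ρ (g i) ≥ b i) →
      Vval γ P π ρ r ≤ Vval γ P πstd ρ r) :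
    -- conclusion: `O(ε)` accuracy within `O((1/ε²)·log(1/ε))` total NPG iterations
    ∃ c₁ c₂ : ℝ, 0 < c₁ ∧ 0 < c₂ ∧
      ∀ ε τ : ℝ, 0 < ε → ε ≤ 1 / 2 →
        τ = (1 - γ) * ε / (4 * Real.log (Fintype.card A)) →
        ∀ (πstar : S → A → ℝ) (lamstar : Fin n → ℝ),
          InSoftmax πstar → (∀ i, Vval γ P πstar ρ (g i) ≥ b i) →
          (∀ π : S → A → ℝ, InSoftmax π → (∀ i, Vval γ P π ρ (g i) ≥ b i) →
            Vtau γ τ P π ρ r ≤ Vtau γ τ P πstar ρ r) →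
          (∀ i, 0 ≤ lamstar i) →
          (∀ μ : Fin n → ℝ, (∀ i, 0 ≤ μ i) →
            Dual γ τ P ρ r g b lamstar ≤ Dual γ τ P ρ r g b μ) →
          Vtau γ τ P πstar ρ r = Dual γ τ P ρ r g b lamstar →
          Dual γ τ P ρ r g b lamstar = Lag γ τ P ρ r g b πstar lamstar →
          ∃ T N₂ N₃ : ℕ,
            -- total number of NPG iterations is `Õ(1/ε²)`
            ((T * N₂ + N₃ : ℕ) : ℝ) ≤ c₁ * (1 / ε ^ 2) * Real.log (1 / ε) ∧
            -- any run of Algorithm 1 with these parameters succeeds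
            ∀ (lam mu : ℕ → Fin n → ℝ) (pit : ℕ → S → A → ℝ) (πout : S → A → ℝ),
              (∀ i, 0 ≤ lam 0 i ∧ lam 0 i ≤
                (Vtau γ τ P πstar ρ r - Vtau γ τ P πbar ρ r) / ξ i) →
              (∀ i, 0 ≤ lam 1 i ∧ lam 1 i ≤
                (Vtau γ τ P πstar ρ r - Vtau γ τ P πbar ρ r) / ξ i) →
              InSoftmax (pit 0) →
              (∀ t : ℕ, mu t = fun i =>
                lam (t + 1) i + (((t : ℝ) - 1) / ((t : ℝ) + 2)) *
                  (lam (t + 1) i - lam t i)) →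
              (∀ t : ℕ, pit (t + 1) =
                (npgStep γ τ ((1 - γ) / τ) P (rLam r g (mu t)))^[N₂] (pit t)) →
              (∀ t : ℕ, lam (t + 2) = fun i =>
                min ((Vtau γ τ P πstar ρ r - Vtau γ τ P πbar ρ r) / ξ i)
                  (max 0 (mu t i -
                    (1 / (2 * Real.log 2 * ((n : ℝ) * Fintype.card A +
                      (1 - γ) ^ 2 * Real.sqrt ((n : ℝ) * Fintype.card A)) /
                        (τ * (1 - γ) ^ 3 * d))) *
                    (Vval γ P (pit (t + 1)) ρ (g i) - b i)))) →
              πout = (npgStep γ τ ((1 - γ) / τ) P (rLam r g (lam (T + 1))))^[N₃]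
                (pit T) →
              |Vval γ P πstd ρ r - Vval γ P πout ρ r| ≤ c₂ * ε ∧
              ∀ i, max (b i - Vval γ P πout ρ (g i)) 0 ≤ c₂ * ε := by
  have : Nonempty A := Fintype.card_pos_iff.1 (zero_lt_one.trans hA)
  have h1γ : 0 < 1 - γ := sub_pos.2 hγ.2
  have h1γ' : 1 - γ ≤ 1 := by linarith [hγ.1]
  have hcard : (1 : ℝ) < Fintype.card A := by exact_mod_cast hA
  have hlogA : 0 < Real.log (Fintype.card A) := Real.log_pos hcard
  obtain ⟨s₀⟩ : Nonempty S := by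
    by_contra hS
    rw [not_nonempty_iff] at hS
    simpa using hρ.2
  have hbarp := hbar.isPolicy
  have hd1 : d ≤ 1 := (hexp πbar hbar s₀).trans (visit_le_one hP hγ hbarp hρ s₀)
  set τ₀ : ℝ := (1 - γ) / (4 * Real.log (Fintype.card A)) with hτ₀
  have hτ₀pos : 0 < τ₀ := by positivity
  set Cl : ℝ := 2 * Real.log 2 * ((n : ℝ) * Fintype.card A +
    (1 - γ) ^ 2 * Real.sqrt ((n : ℝ) * Fintype.card A)) / ((1 - γ) ^ 3 * d) with hCl
  have hlog2 : 0 < Real.log 2 := Real.log_pos one_lt_two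
  have hnpos : (0 : ℝ) < n := by exact_mod_cast hn
  have hClpos : 0 < Cl := by positivity
  set Rb : Fin n → ℝ := fun i => 2 / (1 - γ) / ξ i with hRb
  have hRb0 : ∀ i, 0 ≤ Rb i := fun i => div_nonneg (by positivity) (hξ i).le
  set R₂ : ℝ := ∑ i, Rb i ^ 2 with hR₂
  have hR₂0 : 0 ≤ R₂ := Finset.sum_nonneg fun i _ => sq_nonneg _
  set Cr : ℝ := 1 + ∑ i, 2 * Rb i with hCr
  have hCr0 : 0 ≤ Cr :=
    add_nonneg zero_le_one (Finset.sum_nonneg fun i _ => mul_nonneg two_pos.le (hRb0 i))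
  set e₀ : ℝ := (2 * Cr + 1) / (1 - γ) with he₀
  have he₀0 : 0 ≤ e₀ := by positivity
  set κ₀ : ℝ := τ₀ * (1 - γ) ^ 3 with hκ₀
  have hκ₀pos : 0 < κ₀ := by positivity
  set K₁ : ℝ := 2 * (Cl / τ₀) * R₂ + 16 * e₀ with hK₁
  refine ⟨21 / (1 - γ), 1 + √(K₁ / κ₀) + √(e₀ / κ₀), by positivity, by positivity, ?_⟩
  intro ε τ hε hε' hτε πstar lamstar hstar hstarfeas hstaropt hlamstar hlammin hDstar _
  have hτ₀ε : τ = τ₀ * ε := by rw [hτε, hτ₀]; ring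
  have hτ : 0 < τ := by rw [hτ₀ε]; positivity
  have hτA : τ * Real.log (Fintype.card A) = (1 - γ) * (ε / 4) := by
    rw [hτε]; field_simp
  obtain ⟨T, N, hT, hT', hN, hcount⟩ := exists_iteration_counts hγ hε hε'
  refine ⟨T, N, N, hcount, ?_⟩
  intro lam mu pit πout h0 h1 hpit0 hmu hpit hlam hout
  have hstarp := hstar.isPolicy
  set R : Fin n → ℝ := fun i => (Vtau γ τ P πstar ρ r - Vtau γ τ P πbar ρ r) / ξ i with hR
  have hbarfeas : ∀ i, Vval γ P πbar ρ (g i) ≥ b i := fun i => by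
    linarith [hslater i, hξ i]
  have hgap0 : 0 ≤ Vtau γ τ P πstar ρ r - Vtau γ τ P πbar ρ r :=
    sub_nonneg.2 (hstaropt πbar hbar hbarfeas)
  have hentropy : ∀ π : S → A → ℝ, IsPolicy π →
      Vtau γ τ P π ρ r ≤ Vval γ P π ρ r + ε / 4 := fun π hπ => by
    have h := Vtau_le_Vval_add (c := r) hP hγ hπ hρ hτ.le
    rwa [hτA, mul_div_assoc, mul_div_cancel₀ _ h1γ.ne'] at h
  have hinv : 1 ≤ 1 / (1 - γ) := (one_le_div h1γ).2 h1γ'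
  have hgap : Vtau γ τ P πstar ρ r - Vtau γ τ P πbar ρ r ≤ 2 / (1 - γ) := by
    have h2 := hentropy πstar hstarp
    have h3 := Vval_le hP hγ hstarp hρ (c := r) fun s a => (hr s a).2
    have h4 := Vval_le_Vtau hP hγ hbarp hρ (c := r) hτ.le
    have h5 := le_Vval hP hγ hbarp hρ (c := r) fun s a => (hr s a).1
    rw [zero_div] at h5
    have h6 : 2 / (1 - γ) = 1 / (1 - γ) + 1 / (1 - γ) := by ring
    linarith
  have hR0 : ∀ i, 0 ≤ R i := fun i => div_nonneg hgap0 (hξ i).le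
  have hRRb : ∀ i, R i ≤ Rb i := fun i => div_le_div_of_nonneg_right hgap (hξ i).le
  have hs : ∀ i, 0 ≤ lamstar i ∧ lamstar i ≤ R i := fun i => by
    refine ⟨hlamstar i, ?_⟩
    rw [hR, le_div_iff₀ (hξ i)]
    have h2 : Lag γ τ P ρ r g b πbar lamstar ≤ _ := Lag_le_Dual hP hγ hτ hbarp hρ lamstar
    have h3 : lamstar i * (Vval γ P πbar ρ (g i) - b i) ≤
        ∑ j, lamstar j * (Vval γ P πbar ρ (g j) - b j) :=
      Finset.single_le_sum (f := fun j => lamstar j * (Vval γ P πbar ρ (g j) - b j))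
        (fun j _ => mul_nonneg (hlamstar j) (sub_nonneg.2 (hbarfeas j))) (Finset.mem_univ i)
    have h4 := mul_le_mul_of_nonneg_left (hslater i) (hlamstar i)
    rw [← hDstar, Lag] at h2
    linarith
  have hbox : ∀ t i, 0 ≤ lam (t + 1) i ∧ lam (t + 1) i ≤ R i := fun t i => by
    cases t with
    | zero => exact h1 i
    | succ t =>
      rw [hlam t]
      exact ⟨le_min (hR0 i) (le_max_left _ _), min_le_left _ _⟩
  have hbox' : ∀ t i, 0 ≤ lam t i ∧ lam t i ≤ R i := fun t => by
    cases t with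
    | zero => exact h0
    | succ t => exact hbox t
  have hmuB : ∀ t i, |mu t i| ≤ 2 * Rb i := fun t i => by
    rw [hmu t]
    exact (abs_extrapolation_le (hbox t i) (hbox' t i) t).trans
      (mul_le_mul_of_nonneg_left (hRRb i) two_pos.le)
  have hlamB : ∀ t i, |lam t i| ≤ 2 * Rb i := fun t i => by
    rw [abs_of_nonneg (hbox' t i).1]
    linarith [(hbox' t i).2, hRRb i, hRb0 i]
  have hpitsoft : ∀ t, InSoftmax (pit t) := fun t => by
    induction t with
    | zero => exact hpit0
    | succ t ih =>
      rw [hpit t]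
      exact npg_iterate_inSoftmax hγ hτ ih N
  have hγN : 0 ≤ γ ^ N := pow_nonneg hγ.1 N
  have hnpg : ∀ (π : S → A → ℝ) (ν : Fin n → ℝ), InSoftmax π → (∀ i, |ν i| ≤ 2 * Rb i) →
      Dual γ τ P ρ r g b ν - Lag γ τ P ρ r g b
        ((npgStep γ τ ((1 - γ) / τ) P (rLam r g ν))^[N] π) ν ≤ γ ^ N * e₀ := by
    intro π ν hπ hν
    refine (npg_dual_gap hP hγ hτ hπ hρ (C := Cr) (abs_rLam_le hr hg hν) N).trans ?_
    refine mul_le_mul_of_nonneg_left (div_le_div_of_nonneg_right ?_ h1γ.le) hγN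
    rw [hτA]
    nlinarith
  set ℓ : ℝ := 2 * Real.log 2 * ((n : ℝ) * Fintype.card A +
    (1 - γ) ^ 2 * Real.sqrt ((n : ℝ) * Fintype.card A)) / (τ * (1 - γ) ^ 3 * d) with hℓ
  have hℓCl : ℓ = Cl / (τ₀ * ε) := by
    rw [hℓ, hCl, ← hτ₀ε]; field_simp
  have hℓpos : 0 < ℓ := by rw [hℓCl]; positivity
  have hκτ : τ * (1 - γ) ^ 3 = κ₀ * ε := by rw [hτ₀ε, hκ₀]; ring
  have hℓn : (n : ℝ) / (2 * (τ * (1 - γ) ^ 3)) ≤ ℓ / 2 :=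
    smoothness_constant_le (by positivity) hnpos.le hcard.le hd hd1 (by positivity)
  have horacle : ∀ t x y, Dual γ τ P ρ r g b y - Dual γ τ P ρ r g b x ≤
      ∑ i, (Vval γ P (pit (t + 1)) ρ (g i) - b i) * (y i - x i) +
        ℓ / 2 * ∑ i, (y i - mu t i) ^ 2 + 2 * (γ ^ N * e₀) := by
    intro t x y
    have hgapt := hnpg (pit t) (mu t) (hpitsoft t) (hmuB t)
    rw [← hpit t] at hgapt
    refine (dual_inexact_oracle hP hγ hτ (hpitsoft (t + 1)).isPolicy hρ hn hg hgapt x y).trans ?_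
    gcongr
  have hdescent := accelerated_descent_bound hℓpos (by positivity) hs h0 hbox hmu hlam horacle
    hlammin T
  set ν := lam (T + 1) with hν
  have hv : Dual γ τ P ρ r g b ν - Dual γ τ P ρ r g b lamstar ≤ K₁ * ε ^ 3 := by
    refine dual_gap_rate hε hClpos.le hτ₀pos hR₂0 he₀0 hT hT' hε' hN (hdescent.trans ?_)
    rw [hℓCl, hR₂]
    gcongr with i
    · exact hR0 i
    · exact hRRb i
  obtain ⟨q, -, -, hgrow⟩ := exists_dual_maximizer hP hγ hτ hρ r g b ν
  have hLagge : ∀ (π : S → A → ℝ) (x : Fin n → ℝ), (∀ i, Vval γ P π ρ (g i) ≥ b i) →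
      (∀ i, 0 ≤ x i) → Vtau γ τ P π ρ r ≤ Lag γ τ P ρ r g b π x := fun π x hπ hx =>
    le_add_of_nonneg_right
      (Finset.sum_nonneg fun i _ => mul_nonneg (hx i) (sub_nonneg.2 (hπ i)))
  have hstarq : ∀ u : S → A → ℝ, (∀ s a, u s a ∈ Set.Icc (0 : ℝ) 1) →
      |Vval γ P πstar ρ u - Vval γ P q ρ u| ≤ √(K₁ / κ₀) * ε := fun u hu => by
    refine abs_le_sqrt_div_mul hκ₀pos hε ?_
    rw [← hκτ]
    have h2 := hgrow πstar hstarp u hu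
    have h3 := hLagge πstar ν hstarfeas fun i => (hbox T i).1
    linarith
  have houtsoft : InSoftmax πout := by
    rw [hout]
    exact npg_iterate_inSoftmax hγ hτ (hpitsoft T) N
  have houtq : ∀ u : S → A → ℝ, (∀ s a, u s a ∈ Set.Icc (0 : ℝ) 1) →
      |Vval γ P πout ρ u - Vval γ P q ρ u| ≤ √(e₀ / κ₀) * ε := fun u hu => by
    refine abs_le_sqrt_div_mul hκ₀pos hε ?_
    rw [← hκτ]
    have h2 := hgrow πout houtsoft.isPolicy u hu
    have h3 := hnpg (pit T) ν (hpitsoft T) (hlamB (T + 1))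
    rw [← hout] at h3
    have h4 : γ ^ N ≤ ε ^ 3 :=
      hN.trans (pow_le_pow_of_le_one hε.le (by linarith) (by norm_num))
    have h5 := mul_le_mul_of_nonneg_right h4 he₀0
    linarith
  have hclose : ∀ u : S → A → ℝ, (∀ s a, u s a ∈ Set.Icc (0 : ℝ) 1) →
      |Vval γ P πstar ρ u - Vval γ P πout ρ u| ≤ (√(K₁ / κ₀) + √(e₀ / κ₀)) * ε := fun u hu => by
    have h2 := abs_sub_le (Vval γ P πstar ρ u) (Vval γ P q ρ u) (Vval γ P πout ρ u)
    rw [abs_sub_comm (Vval γ P q ρ u)] at h2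
    linarith [hstarq u hu, houtq u hu]
  have hlow := hstdopt πstar hstarp hstarfeas
  have hupp : Vval γ P πstd ρ r ≤ Vval γ P πstar ρ r + ε / 4 := by
    have h2 := Vval_le_Vtau hP hγ hstd hρ (c := r) hτ.le
    have h3 := hLagge πstd lamstar hstdfeas hlamstar
    have h4 : Lag γ τ P ρ r g b πstd lamstar ≤ _ := Lag_le_Dual hP hγ hτ hstd hρ lamstar
    rw [← hDstar] at h4
    linarith [hentropy πstar hstarp]
  have hc₂ : (1 + √(K₁ / κ₀) + √(e₀ / κ₀)) * ε = ε + (√(K₁ / κ₀) + √(e₀ / κ₀)) * ε := by ring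
  rw [hc₂]
  have hc₂0 : 0 ≤ (√(K₁ / κ₀) + √(e₀ / κ₀)) * ε := by positivity
  constructor
  · have h2 := abs_le.1 (hclose r hr)
    rw [abs_le]
    constructor <;> linarith only [h2.1, h2.2, hlow, hupp, hε]
  · intro i
    have h2 := (abs_le.1 (hclose (g i) (hg i))).2
    have h3 := hstarfeas i
    exact max_le (by linarith only [h2, h3, hε]) (by linarith only [hc₂0, hε])
end

section
/- Assume the unregularized Lagrangian L₀(π,λ) = V^π(ρ) + Σ_i λ_i·(U_{g_i}^π(ρ) − b_i) satisfies strong duality, i.e. min_{λ≥0} max_{π∈Π} L₀(π,λ) = max_{π∈Π} min_{λ≥0} L₀(π,λ) (all extrema attained). Then the duality gap of the entropy-regularized Lagrangian satisfies 0 ≤ min_{λ≥0} max_{π∈Π} L(π,λ) − max_{π∈Π} min_{λ≥0} L(π,λ) ≤ (τ/(1−γ))·log|A|. -/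
open scoped BigOperators

/-- The unregularized Lagrangian `L₀(π, λ)`. -/
noncomputable def Lag0 {S A : Type} [Fintype S] [Fintype A]
    (γ : ℝ) (P : S → A → S → ℝ) (ρ : S → ℝ) (r : S → A → ℝ)
    {n : ℕ} (g : Fin n → S → A → ℝ) (b : Fin n → ℝ) (π : S → A → ℝ)
    (lam : Fin n → ℝ) : ℝ :=
  Vval γ P π ρ r + ∑ i, lam i * (Vval γ P π ρ (g i) - b i)

lemma softmaxPol_pos {S A : Type} [Fintype A] [Nonempty A] (θ : S → A → ℝ) (s : S) (a : A) :
    0 < softmaxPol θ s a :=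
  div_pos (Real.exp_pos _) (Finset.sum_pos (fun _ _ => Real.exp_pos _) Finset.univ_nonempty)

lemma sum_softmaxPol {S A : Type} [Fintype A] [Nonempty A] (θ : S → A → ℝ) (s : S) :
    ∑ a, softmaxPol θ s a = 1 := by
  have h : 0 < ∑ a, Real.exp (θ s a) :=
    Finset.sum_pos (fun _ _ => Real.exp_pos _) Finset.univ_nonempty
  simp only [softmaxPol, ← Finset.sum_div]
  exact div_self h.ne'

/-- The state-action law of the chain factors through a state distribution and the policy. -/
lemma trajSA_initSA_eq_s19 {S A : Type} [Fintype S] [Fintype A] (P : S → A → S → ℝ)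
    (hP : IsKernel P) (ρ : S → ℝ) (hρ : IsDist ρ)
    (π : S → A → ℝ) (hπ : IsPolicy π) (t : ℕ) :
    ∃ m : S → ℝ, IsDist m ∧ trajSA P π (initSA ρ π) t = initSA m π := by
  induction t with
  | zero => exact ⟨ρ, hρ, rfl⟩
  | succ t ih =>
    obtain ⟨m, hm, h⟩ := ih
    refine ⟨fun s => ∑ s', ∑ a', initSA m π s' a' * P s' a' s, ⟨fun s => ?_, ?_⟩, ?_⟩
    · exact Finset.sum_nonneg fun s' _ => Finset.sum_nonneg fun a' _ =>
        mul_nonneg (mul_nonneg (hm.1 _) (hπ.1 _ _)) (hP.1 _ _ _)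
    · rw [Finset.sum_comm]
      simp_rw [Finset.sum_comm (s := (Finset.univ : Finset S)) (t := (Finset.univ : Finset A)),
        ← Finset.mul_sum, hP.2, mul_one]
      rw [Finset.sum_comm]
      simp_rw [initSA, ← Finset.mul_sum, hπ.2, mul_one]
      exact hm.2
    · simp only [trajSA, h]
      rfl

/-- The entropy of a positive probability vector is at most the logarithm of its length. -/
lemma sum_mul_neg_log_le_log_card {A : Type*} [Fintype A] [Nonempty A] (p : A → ℝ)
    (hp : ∀ a, 0 < p a)
    (hp1 : ∑ a, p a = 1) : ∑ a, p a * -Real.log (p a) ≤ Real.log (Fintype.card A) := by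
  have hN : (0 : ℝ) < Fintype.card A := by exact_mod_cast Fintype.card_pos
  have key : ∀ a, p a * -Real.log (p a) ≤
      p a * Real.log (Fintype.card A) + ((Fintype.card A : ℝ)⁻¹ - p a) := fun a => by
    have h := Real.log_le_sub_one_of_pos (inv_pos.2 (mul_pos hN (hp a)))
    rw [Real.log_inv, Real.log_mul hN.ne' (hp a).ne'] at h
    have h2 := mul_le_mul_of_nonneg_left h (hp a).le
    have h3 : p a * (((Fintype.card A : ℝ) * p a)⁻¹ - 1) = (Fintype.card A : ℝ)⁻¹ - p a := by
      have := (hp a).ne'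
      field_simp
    linarith
  refine (Finset.sum_le_sum fun a _ => key a).trans ?_
  rw [Finset.sum_add_distrib, ← Finset.sum_mul, Finset.sum_sub_distrib, hp1]
  simp [hN.ne']

/-- The discounted entropy of a soft-max policy lies between `0` and `log |A| / (1 - γ)`. -/
lemma Hent_softmaxPol_mem_Icc {S A : Type} [Fintype S] [Fintype A]
    (γ : ℝ) (hγ : γ ∈ Set.Ico (0 : ℝ) 1) (P : S → A → S → ℝ)
    (hP : IsKernel P) (ρ : S → ℝ) (hρ : IsDist ρ) (θ : S → A → ℝ) :
    Hent γ P (softmaxPol θ) ρ ∈ Set.Icc 0 (Real.log (Fintype.card A) / (1 - γ)) := by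
  rcases isEmpty_or_nonempty A with hA | hA
  · simp [Hent, Vval, dsum]
  have hπ : IsPolicy (softmaxPol θ) :=
    ⟨fun s a => (softmaxPol_pos θ s a).le, sum_softmaxPol θ⟩
  have hle1 : ∀ s a, softmaxPol θ s a ≤ 1 := fun s a =>
    (Finset.single_le_sum (fun a _ => hπ.1 s a) (Finset.mem_univ a)).trans_eq (hπ.2 s)
  have hstep : ∀ t, (∑ s, ∑ a, trajSA P (softmaxPol θ) (initSA ρ (softmaxPol θ)) t s a *
      -Real.log (softmaxPol θ s a)) ∈ Set.Icc 0 (Real.log (Fintype.card A)) := fun t => by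
    obtain ⟨m, hm, h⟩ := trajSA_initSA_eq_s19 P hP ρ hρ _ hπ t
    simp_rw [h, initSA, mul_assoc, ← Finset.mul_sum]
    constructor
    · exact Finset.sum_nonneg fun s _ => mul_nonneg (hm.1 s) <| Finset.sum_nonneg fun a _ =>
        mul_nonneg (hπ.1 s a) (neg_nonneg.2 (Real.log_nonpos (hπ.1 s a) (hle1 s a)))
    · calc _ ≤ ∑ s, m s * Real.log (Fintype.card A) := Finset.sum_le_sum fun s _ =>
            mul_le_mul_of_nonneg_left
              (sum_mul_neg_log_le_log_card _ (softmaxPol_pos θ s) (hπ.2 s)) (hm.1 s)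
        _ = _ := by rw [← Finset.sum_mul, hm.2, one_mul]
  have hgeom := (hasSum_geometric_of_lt_one hγ.1 hγ.2).mul_right (Real.log (Fintype.card A))
  have h0 : ∀ t, 0 ≤ γ ^ t * ∑ s, ∑ a,
      trajSA P (softmaxPol θ) (initSA ρ (softmaxPol θ)) t s a *
        -Real.log (softmaxPol θ s a) := fun t =>
    mul_nonneg (pow_nonneg hγ.1 t) (hstep t).1
  have hle : ∀ t, γ ^ t * ∑ s, ∑ a,
      trajSA P (softmaxPol θ) (initSA ρ (softmaxPol θ)) t s a *
        -Real.log (softmaxPol θ s a) ≤ γ ^ t * Real.log (Fintype.card A) := fun t =>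
    mul_le_mul_of_nonneg_left (hstep t).2 (pow_nonneg hγ.1 t)
  refine ⟨tsum_nonneg h0, ?_⟩
  rw [div_eq_inv_mul, ← hgeom.tsum_eq]
  exact (Summable.of_nonneg_of_le h0 hle hgeom.summable).tsum_le_tsum hle hgeom.summable

/-- duality gap of the entropy-regularized Lagrangian: if the
unregularized Lagrangian satisfies strong duality (minimax = maximin, with the extrema
attained at a saddle point), then
`0 ≤ min_{λ≥0} max_{π∈Π} L(π,λ) − max_{π∈Π} min_{λ≥0} L(π,λ) ≤ (τ/(1−γ))·log|A|`. -/
theorem entropy_regularized_duality_gap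
    {S A : Type} [Fintype S] [Fintype A]
    (P : S → A → S → ℝ) (r : S → A → ℝ) (γ τ : ℝ) (ρ : S → ℝ) {n : ℕ}
    (g : Fin n → S → A → ℝ) (b : Fin n → ℝ)
    (hP : IsKernel P) (hr : ∀ s a, r s a ∈ Set.Icc (0 : ℝ) 1)
    (hγ : γ ∈ Set.Ico (0 : ℝ) 1) (hρ : IsDist ρ) (hτ : 0 < τ)
    (hg : ∀ i s a, g i s a ∈ Set.Icc (0 : ℝ) 1)
    (hb : ∀ i, b i ∈ Set.Icc (0 : ℝ) (1 / (1 - γ)))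
    -- strong duality for the unregularized Lagrangian: minimax = maximin ...
    (hsd0 : (⨅ lam ∈ {lam : Fin n → ℝ | ∀ i, 0 ≤ lam i},
        ⨆ π ∈ {π : S → A → ℝ | InSoftmax π}, (Lag0 γ P ρ r g b π lam : EReal)) =
      ⨆ π ∈ {π : S → A → ℝ | InSoftmax π},
        ⨅ lam ∈ {lam : Fin n → ℝ | ∀ i, 0 ≤ lam i}, (Lag0 γ P ρ r g b π lam : EReal))
    -- ... with all extrema attained (at a saddle point)
    (hattain : ∃ (π0 : S → A → ℝ) (lam0 : Fin n → ℝ), InSoftmax π0 ∧ (∀ i, 0 ≤ lam0 i) ∧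
      (∀ π : S → A → ℝ, InSoftmax π → Lag0 γ P ρ r g b π lam0 ≤ Lag0 γ P ρ r g b π0 lam0) ∧
      (∀ lam : Fin n → ℝ, (∀ i, 0 ≤ lam i) →
        Lag0 γ P ρ r g b π0 lam0 ≤ Lag0 γ P ρ r g b π0 lam)) :
    0 ≤ (⨅ lam ∈ {lam : Fin n → ℝ | ∀ i, 0 ≤ lam i},
          ⨆ π ∈ {π : S → A → ℝ | InSoftmax π}, (Lag γ τ P ρ r g b π lam : EReal)) -
        (⨆ π ∈ {π : S → A → ℝ | InSoftmax π},
          ⨅ lam ∈ {lam : Fin n → ℝ | ∀ i, 0 ≤ lam i},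
            (Lag γ τ P ρ r g b π lam : EReal)) ∧
      (⨅ lam ∈ {lam : Fin n → ℝ | ∀ i, 0 ≤ lam i},
          ⨆ π ∈ {π : S → A → ℝ | InSoftmax π}, (Lag γ τ P ρ r g b π lam : EReal)) -
        (⨆ π ∈ {π : S → A → ℝ | InSoftmax π},
          ⨅ lam ∈ {lam : Fin n → ℝ | ∀ i, 0 ≤ lam i},
            (Lag γ τ P ρ r g b π lam : EReal)) ≤
        ((τ / (1 - γ)) * Real.log (Fintype.card A) : ℝ) := by
  obtain ⟨π0, lam0, hπ0, hlam0, hmax, hmin⟩ := hattain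
  have hLag : ∀ π lam, Lag γ τ P ρ r g b π lam =
      Lag0 γ P ρ r g b π lam + τ * Hent γ P π ρ := fun π lam => by
    simp only [Lag, Lag0, Vtau]
    ring
  have hH : ∀ π, InSoftmax π →
      Hent γ P π ρ ∈ Set.Icc 0 (Real.log (Fintype.card A) / (1 - γ)) := by
    rintro _ ⟨θ, rfl⟩
    exact Hent_softmaxPol_mem_Icc γ hγ P hP ρ hρ θ
  set c := Lag0 γ P ρ r g b π0 lam0
  set K := τ / (1 - γ) * Real.log (Fintype.card A)
  have hX : (⨅ lam ∈ {lam : Fin n → ℝ | ∀ i, 0 ≤ lam i},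
      ⨆ π ∈ {π : S → A → ℝ | InSoftmax π}, (Lag γ τ P ρ r g b π lam : EReal)) ≤
      ((c + K : ℝ) : EReal) := by
    refine (iInf₂_le lam0 hlam0).trans (iSup₂_le fun π hπ => EReal.coe_le_coe_iff.2 ?_)
    rw [hLag]
    refine add_le_add (hmax π hπ) ((mul_le_mul_of_nonneg_left (hH π hπ).2 hτ.le).trans_eq ?_)
    simp only [K]
    ring
  have hY : (c : EReal) ≤ ⨆ π ∈ {π : S → A → ℝ | InSoftmax π},
      ⨅ lam ∈ {lam : Fin n → ℝ | ∀ i, 0 ≤ lam i}, (Lag γ τ P ρ r g b π lam : EReal) := by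
    refine le_iSup₂_of_le π0 hπ0 (le_iInf₂ fun lam hlam => EReal.coe_le_coe_iff.2 ?_)
    rw [hLag]
    exact (hmin lam hlam).trans (le_add_of_nonneg_right (mul_nonneg hτ.le (hH π0 hπ0).1))
  constructor
  · refine (EReal.sub_nonneg (Or.inl (ne_top_of_le_ne_top (EReal.coe_ne_top _) hX))
      (Or.inr (ne_bot_of_le_ne_bot (EReal.coe_ne_bot _) hY))).2 ?_
    exact iSup₂_le fun π hπ => le_iInf₂ fun lam hlam =>
      (iInf₂_le lam hlam).trans
        (le_iSup₂ (f := fun π (_ : π ∈ {π : S → A → ℝ | InSoftmax π}) =>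
          (Lag γ τ P ρ r g b π lam : EReal)) π hπ)
  · refine (EReal.sub_le_sub hX hY).trans_eq ?_
    rw [← EReal.coe_sub, add_sub_cancel_left]
end
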